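/- arXiv:2604.28172 — 4 statements merged into one kernel-verified Lean document; each statement's English description precedes it below -/
import Mathlib

section
/- There is a constant c > 0 such that for all sufficiently small ε > 0 and for all reals d, D, δ > 0 and integers k, n satisfying δ > cε, k ≤ n^{δ/60}, D ≤ 2 log n, and d = εD, the following holds for any family Q ⊆ 2^T of size |Q| ≤ exp(n^{2−δ}) with T ∈ Q. If a k-partite graph G is (Q, D, δ)-good, then μ_{G,d}(T) ≥ 1 − n^{−c'} for some constant c' > 0 depending only on ε and δ. -/
open Finset

abbrev Vtx (k n : ℕ) := Fin k × Fin n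
abbrev Tup (k n : ℕ) := Fin k → Fin n

/-- Potential edges: pairs of vertices lying in distinct blocks. -/
def potEdges (k n : ℕ) : Finset (Sym2 (Vtx k n)) :=
  Finset.univ.filter fun e => ¬ (Sym2.map Prod.fst e).IsDiag

open Classical in
/-- The probability, under the distribution `G(n,k,p)` (each potential edge present
independently with probability `p`), that the sampled graph satisfies `P`. -/
noncomputable def probG (k n : ℕ) (p : ℝ) (P : Finset (Sym2 (Vtx k n)) → Prop) : ℝ :=
  ∑ G ∈ (potEdges k n).powerset,
    if P G then p ^ G.card * (1 - p) ^ ((potEdges k n).card - G.card) else 0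

/-- The biased character `χ_E(G) = ∏_{e ∈ E} χ_e(G)`. -/
noncomputable def chiE {k n : ℕ} (p : ℝ) (G E : Finset (Sym2 (Vtx k n))) : ℝ :=
  ∏ e ∈ E, if e ∈ G then (1 - p) / p else -1

/-- The edge of a tuple `t` joining its vertices in blocks `i` and `j`. -/
def tupEdge {k n : ℕ} (t : Tup k n) (i j : Fin k) : Sym2 (Vtx k n) := s((i, t i), (j, t j))

/-- `t` is a `k`-clique of `G`. -/
def IsClique {k n : ℕ} (G : Finset (Sym2 (Vtx k n))) (t : Tup k n) : Prop :=
  ∀ i j : Fin k, i ≠ j → tupEdge t i j ∈ G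

/-- `S` is a vertex cover of the graph `H` on `[k]`. -/
def IsCover {k : ℕ} (H : Finset (Sym2 (Fin k))) (S : Finset (Fin k)) : Prop :=
  ∀ e ∈ H, ∃ v ∈ S, v ∈ e

/-- Minimum vertex cover size. -/
noncomputable def vc {k : ℕ} (H : Finset (Sym2 (Fin k))) : ℕ :=
  sInf {m | ∃ S : Finset (Fin k), S.card = m ∧ IsCover H S}

/-- The graph `H(t)` on the vertices of the tuple `t` obtained from a graph `H` on `[k]`. -/
def graphOf {k n : ℕ} (H : Finset (Sym2 (Fin k))) (t : Tup k n) : Finset (Sym2 (Vtx k n)) :=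
  H.image (Sym2.map fun i => (i, t i))

open Classical in
/-- The pseudo-measure `μ_{G,d}` on a single tuple. -/
noncomputable def mu {k n : ℕ} (p : ℝ) (G : Finset (Sym2 (Vtx k n))) (d : ℝ) (t : Tup k n) : ℝ :=
  ((n : ℝ) ^ k)⁻¹ *
    ∑ H ∈ Finset.univ.filter
        (fun H : Finset (Sym2 (Fin k)) => (∀ e ∈ H, ¬ e.IsDiag) ∧ (vc H : ℝ) ≤ d),
      chiE p G (graphOf H t)

/-- The pseudo-measure `μ_{G,d}` on a set of tuples. -/
noncomputable def muSet {k n : ℕ} (p : ℝ) (G : Finset (Sym2 (Vtx k n))) (d : ℝ)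
    (Q : Finset (Tup k n)) : ℝ :=
  ∑ t ∈ Q, mu p G d t

/-- `Q` is ruled out by a missing edge: some potential edge `e ∉ E(G)` satisfies `e ⊆ t`
for every `t ∈ Q`. -/
def RuledOut {k n : ℕ} (G : Finset (Sym2 (Vtx k n))) (Q : Finset (Tup k n)) : Prop :=
  ∃ e ∈ potEdges k n, e ∉ G ∧ ∀ t ∈ Q, ∀ u ∈ e, t u.1 = u.2


/-- The set of non-isolated vertices `V(E(H))` of a graph `H` on `[k]`. -/
def nonIsolated {k : ℕ} (H : Finset (Sym2 (Fin k))) : Finset (Fin k) :=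
  Finset.univ.filter fun v => ∃ e ∈ H, v ∈ e

/-- `F` is a vertex-induced subgraph of `H`. -/
def IsInduced {k : ℕ} (F H : Finset (Sym2 (Fin k))) : Prop :=
  ∃ S : Finset (Fin k), ∀ e, e ∈ F ↔ e ∈ H ∧ ∀ v ∈ e, v ∈ S

/-- `F` is a core of `H`: a vertex-induced subgraph of `H` every minimum vertex cover
of which is a vertex cover of `H`. -/
def IsCore {k : ℕ} (F H : Finset (Sym2 (Fin k))) : Prop :=
  IsInduced F H ∧ ∀ S : Finset (Fin k), IsCover F S → S.card = vc F → IsCover H S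

/-- A graph on `[k]` (identified with its edge set) has no diagonal "edges". -/
def IsGraph {k : ℕ} (H : Finset (Sym2 (Fin k))) : Prop := ∀ e ∈ H, ¬ e.IsDiag

/-- The specification of the core map of Lemma 4.2: `core` maps every graph to one of its
cores, and for every `F` in the image of `core` we have `|V(E(F))| ≤ 3·vc(F)` and there is
an edge set `E*_F ⊆ V(E(F)) × ([k] ∖ V(E(F)))` (here provided by the function `Estar`)
such that `core H = F` iff `E(H) = E(F) ⊔ E` for some `E ⊆ E*_F`. -/
def CoreMapSpec (k : ℕ) (core Estar : Finset (Sym2 (Fin k)) → Finset (Sym2 (Fin k))) : Prop :=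
  (∀ H, IsGraph H → IsCore (core H) H) ∧
  ∀ F, (∃ H, IsGraph H ∧ core H = F) →
    (nonIsolated F).card ≤ 3 * vc F ∧
    (∀ e ∈ Estar F, ∃ u v, e = s(u, v) ∧ u ∈ nonIsolated F ∧ v ∉ nonIsolated F) ∧
    (∀ H, IsGraph H → (core H = F ↔ ∃ E ⊆ Estar F, Disjoint F E ∧ H = F ∪ E))

/-- The family `F_d` of cores of graphs on `[k]` with vertex cover at most `d`. -/
def coreSet {k : ℕ} (core : Finset (Sym2 (Fin k)) → Finset (Sym2 (Fin k))) (d : ℝ) :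
    Set (Finset (Sym2 (Fin k))) :=
  {F | ∃ H, IsGraph H ∧ (vc H : ℝ) ≤ d ∧ core H = F}

/-- The family `H_F = {F ⊔ E : E ⊆ E*_F}`. -/
def HFam {k : ℕ} (F EstarF : Finset (Sym2 (Fin k))) : Finset (Finset (Sym2 (Fin k))) :=
  EstarF.powerset.image fun E => F ∪ E

/-- `G` is `s`-bounded over `Q` and the core `F`. -/
noncomputable def SBounded {k n : ℕ} (p : ℝ) (G : Finset (Sym2 (Vtx k n)))
    (Q : Finset (Tup k n)) (F EstarF : Finset (Sym2 (Fin k))) (s : ℝ) : Prop :=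
  ((n : ℝ) ^ k)⁻¹ * |∑ t ∈ Q, ∑ H ∈ HFam F EstarF, chiE p G (graphOf H t)| ≤ s

/-- `G` is `(𝒬, D, δ)`-good. -/
noncomputable def Good {k n : ℕ} (p : ℝ)
    (core Estar : Finset (Sym2 (Fin k)) → Finset (Sym2 (Fin k)))
    (D δ : ℝ) (𝒬 : Finset (Finset (Tup k n))) (G : Finset (Sym2 (Vtx k n))) : Prop :=
  ∀ Q ∈ 𝒬, ∀ F ∈ coreSet core (D / 4), F.Nonempty →
    SBounded p G Q F (Estar F)
      ((n : ℝ) ^ (2 * (F.card : ℝ) / D - δ * (vc F : ℝ) / 10))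


theorem aux_cover_univ {k : ℕ} (H : Finset (Sym2 (Fin k))) : IsCover H Finset.univ := by
  intro e _
  induction e using Sym2.ind with
  | _ a b => exact ⟨a, Finset.mem_univ _, by simp⟩

theorem aux_vc_spec {k : ℕ} (H : Finset (Sym2 (Fin k))) :
    ∃ S : Finset (Fin k), S.card = vc H ∧ IsCover H S :=
  Nat.sInf_mem (s := {m | ∃ S : Finset (Fin k), S.card = m ∧ IsCover H S})
    ⟨_, Finset.univ, rfl, aux_cover_univ H⟩

theorem aux_vc_le {k : ℕ} {H : Finset (Sym2 (Fin k))} {S : Finset (Fin k)}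
    (h : IsCover H S) : vc H ≤ S.card :=
  Nat.sInf_le ⟨S, rfl, h⟩

theorem aux_core_subset {k : ℕ} {F H : Finset (Sym2 (Fin k))} (h : IsCore F H) : F ⊆ H := by
  obtain ⟨⟨S, hS⟩, _⟩ := h
  intro e he
  exact ((hS e).1 he).1

theorem aux_vc_core {k : ℕ} {F H : Finset (Sym2 (Fin k))} (h : IsCore F H) : vc F = vc H := by
  apply le_antisymm
  · obtain ⟨S, hS, hc⟩ := aux_vc_spec H
    rw [← hS]
    exact aux_vc_le fun e he => hc e (aux_core_subset h he)
  · obtain ⟨S, hS, hc⟩ := aux_vc_spec F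
    rw [← hS]
    exact aux_vc_le (h.2 S hc hS)

theorem aux_vc_pos {k : ℕ} {F : Finset (Sym2 (Fin k))} (h : F.Nonempty) : 1 ≤ vc F := by
  obtain ⟨S, hS, hc⟩ := aux_vc_spec F
  obtain ⟨e, he⟩ := h
  obtain ⟨v, hv, _⟩ := hc e he
  rw [← hS]
  exact Finset.card_pos.2 ⟨v, hv⟩

theorem aux_vc_empty {k : ℕ} : vc (∅ : Finset (Sym2 (Fin k))) = 0 := by
  have : vc (∅ : Finset (Sym2 (Fin k))) ≤ (∅ : Finset (Fin k)).card :=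
    aux_vc_le (by intro e he; simp at he)
  simpa using this

theorem aux_enum {α : Type*} [DecidableEq α] (S : Finset α) (hS : S.Nonempty) (m : ℕ)
    (h : S.card ≤ m) : ∃ f : Fin m → α, ∀ x ∈ S, ∃ i, f i = x := by
  obtain ⟨a, _⟩ := hS
  refine ⟨fun i => if hi : (i : ℕ) < S.card then (S.equivFin.symm ⟨i, hi⟩ : α) else a, ?_⟩
  intro x hx
  refine ⟨⟨S.equivFin ⟨x, hx⟩, lt_of_lt_of_le (Fin.is_lt _) h⟩, ?_⟩
  simp

/-- The parametrization of cores. -/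
def auxParam {k : ℕ} (v : ℕ)
    (x : (Fin v → Fin k) × (Fin (3 * v) → Fin k) × Finset (Fin v × Fin (3 * v))) :
    Finset (Sym2 (Fin k)) :=
  x.2.2.image fun q => s(x.1 q.1, x.2.1 q.2)

theorem aux_repr {k : ℕ} (F : Finset (Sym2 (Fin k))) (hF : F.Nonempty)
    (h3 : (nonIsolated F).card ≤ 3 * vc F) : ∃ x, auxParam (vc F) x = F := by
  obtain ⟨S, hS, hc⟩ := aux_vc_spec F
  have hSne : S.Nonempty := by
    rw [← Finset.card_pos, hS]; exact aux_vc_pos hF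
  have hmem : ∀ e ∈ F, ∀ w ∈ e, w ∈ nonIsolated F := by
    intro e he w hw
    simp only [nonIsolated, Finset.mem_filter, Finset.mem_univ, true_and]
    exact ⟨e, he, hw⟩
  have hWne : (nonIsolated F).Nonempty := by
    obtain ⟨e, he⟩ := hF
    obtain ⟨v, _, hv⟩ := hc e he
    exact ⟨v, hmem e he v hv⟩
  obtain ⟨f, hf⟩ := aux_enum S hSne (vc F) hS.le
  obtain ⟨g, hg⟩ := aux_enum _ hWne (3 * vc F) h3
  refine ⟨⟨f, g, Finset.univ.filter fun q => s(f q.1, g q.2) ∈ F⟩, ?_⟩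
  ext e
  simp only [auxParam, Finset.mem_image, Finset.mem_filter, Finset.mem_univ, true_and]
  constructor
  · rintro ⟨q, hq, rfl⟩; exact hq
  · intro he
    obtain ⟨a, ha, hae⟩ := hc e he
    obtain ⟨b, rfl⟩ := Sym2.mem_iff_exists.1 hae
    obtain ⟨i, hi⟩ := hf a ha
    obtain ⟨j, hj⟩ := hg b (hmem _ he b (by simp))
    exact ⟨(i, j), by simpa [hi, hj] using he, by simp [hi, hj]⟩

theorem aux_card_le {k : ℕ} (F : Finset (Sym2 (Fin k))) (hF : F.Nonempty)
    (h3 : (nonIsolated F).card ≤ 3 * vc F) : F.card ≤ vc F * (3 * vc F) := by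
  obtain ⟨x, hx⟩ := aux_repr F hF h3
  calc F.card = (auxParam (vc F) x).card := by rw [hx]
    _ ≤ x.2.2.card := Finset.card_image_le
    _ ≤ _ := by
      refine (Finset.card_le_univ _).trans ?_
      simp

theorem aux_count {k : ℕ} (v : ℕ) (𝓕 : Finset (Finset (Sym2 (Fin k))))
    (h : ∀ F ∈ 𝓕, F.Nonempty ∧ (nonIsolated F).card ≤ 3 * vc F ∧ vc F = v) :
    𝓕.card ≤ k ^ (4 * v) * 2 ^ (v * (3 * v)) := by
  have hsub : 𝓕 ⊆ Finset.univ.image (auxParam (k := k) v) := by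
    intro F hF
    obtain ⟨h1, h2, h4⟩ := h F hF
    obtain ⟨x, hx⟩ := aux_repr F h1 h2
    subst h4
    exact Finset.mem_image.2 ⟨x, Finset.mem_univ _, hx⟩
  refine (Finset.card_le_card hsub).trans (Finset.card_image_le.trans ?_)
  simp only [Finset.card_univ, Fintype.card_prod, Fintype.card_fun, Fintype.card_fin,
    Fintype.card_finset]
  rw [← mul_assoc, ← pow_add]
  apply le_of_eq
  congr 2
  ring

theorem aux_geom (x : ℝ) (h0 : 0 ≤ x) (h1 : x ≤ 1 / 2) (N : ℕ) :
    ∑ v ∈ Finset.Icc 1 N, x ^ v ≤ 2 * x := by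
  have : ∑ v ∈ Finset.Icc 1 N, x ^ v ≤ 2 * x - 2 * x ^ (N + 1) := by
    induction N with
    | zero => simp
    | succ N ih =>
      rw [Finset.sum_Icc_succ_top (by omega)]
      have : x ^ (N + 1 + 1) ≤ x ^ (N + 1) * (1 / 2) := by
        rw [pow_succ _ (N + 1)]
        exact mul_le_mul_of_nonneg_left h1 (by positivity)
      linarith
  have := pow_nonneg h0 (N + 1)
  linarith

theorem aux_fiber {k : ℕ} {core Estar : Finset (Sym2 (Fin k)) → Finset (Sym2 (Fin k))}
    (hs : CoreMapSpec k core Estar) (d : ℝ) (s : Finset (Finset (Sym2 (Fin k))))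
    (hmem : ∀ H, H ∈ s ↔ IsGraph H ∧ (vc H : ℝ) ≤ d)
    (F : Finset (Sym2 (Fin k))) (hF : F ∈ s.image core) :
    s.filter (fun H => core H = F) = HFam F (Estar F) := by
  obtain ⟨H₀, hH₀, hcF⟩ := Finset.mem_image.1 hF
  have hH := (hmem H₀).1 hH₀
  obtain ⟨_, hE, hiff⟩ := hs.2 F ⟨H₀, hH.1, hcF⟩
  have hcore := hs.1 H₀ hH.1
  rw [hcF] at hcore
  ext H
  simp only [Finset.mem_filter, HFam, Finset.mem_image, Finset.mem_powerset]
  constructor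
  · rintro ⟨h1, h2⟩
    obtain ⟨E, hE1, _, hE3⟩ := (hiff H ((hmem H).1 h1).1).1 h2
    exact ⟨E, hE1, hE3.symm⟩
  · rintro ⟨E, hE1, rfl⟩
    have hg : IsGraph (F ∪ E) := by
      intro e he
      rcases Finset.mem_union.1 he with he | he
      · exact hH.1 e (aux_core_subset hcore he)
      · obtain ⟨u, v, rfl, hu, hv⟩ := hE e (hE1 he)
        intro hd
        rw [Sym2.mk_isDiag_iff] at hd
        subst hd
        exact hv hu
    have hdis : Disjoint F E := by
      rw [Finset.disjoint_left]
      intro e he he'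
      obtain ⟨u, v, rfl, hu, hv⟩ := hE e (hE1 he')
      apply hv
      simp only [nonIsolated, Finset.mem_filter, Finset.mem_univ, true_and]
      exact ⟨_, he, by simp⟩
    have hc := (hiff _ hg).2 ⟨E, hE1, hdis, rfl⟩
    refine ⟨(hmem _).2 ⟨hg, ?_⟩, hc⟩
    have h1 := aux_vc_core (hs.1 _ hg)
    rw [hc, aux_vc_core hcore] at h1
    rw [← h1]
    exact hH.2

theorem aux_decomp {k n : ℕ} (hn : 0 < n)
    {core Estar : Finset (Sym2 (Fin k)) → Finset (Sym2 (Fin k))}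
    (hs : CoreMapSpec k core Estar) (p d : ℝ) (hd : 0 < d)
    (G : Finset (Sym2 (Vtx k n))) :
    ∃ 𝓕 : Finset (Finset (Sym2 (Fin k))),
      (∀ F ∈ 𝓕, F ∈ coreSet core d ∧ F.Nonempty ∧ (nonIsolated F).card ≤ 3 * vc F ∧
        (vc F : ℝ) ≤ d) ∧
      muSet p G d Finset.univ = 1 + ∑ F ∈ 𝓕, ((n : ℝ) ^ k)⁻¹ *
        ∑ t : Tup k n, ∑ H ∈ HFam F (Estar F), chiE p G (graphOf H t) := by
  classical
  obtain ⟨s, hsdef⟩ : ∃ s : Finset (Finset (Sym2 (Fin k))),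
    s = Finset.univ.filter
        (fun H : Finset (Sym2 (Fin k)) => (∀ e ∈ H, ¬ e.IsDiag) ∧ (vc H : ℝ) ≤ d) := ⟨_, rfl⟩
  have hmem : ∀ H, H ∈ s ↔ IsGraph H ∧ (vc H : ℝ) ≤ d := by
    intro H
    rw [hsdef]
    simp [IsGraph]
  have hes : ∅ ∈ s := by
    rw [hmem]
    refine ⟨by intro e he; simp at he, ?_⟩
    rw [aux_vc_empty]; simpa using hd.le
  have hg0 : IsGraph (∅ : Finset (Sym2 (Fin k))) := ((hmem _).1 hes).1
  have hce : core ∅ = ∅ := Finset.subset_empty.1 (aux_core_subset (hs.1 ∅ hg0))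
  have hei : ∅ ∈ s.image core := Finset.mem_image.2 ⟨∅, hes, hce⟩
  refine ⟨(s.image core).erase ∅, ?_, ?_⟩
  · intro F hF
    obtain ⟨hne, hF⟩ := Finset.mem_erase.1 hF
    obtain ⟨H, hH, rfl⟩ := Finset.mem_image.1 hF
    obtain ⟨h1, h2⟩ := (hmem H).1 hH
    refine ⟨⟨H, h1, h2, rfl⟩, Finset.nonempty_iff_ne_empty.2 hne, (hs.2 _ ⟨H, h1, rfl⟩).1, ?_⟩
    rw [aux_vc_core (hs.1 H h1)]
    exact h2
  · have hmu : ∀ t : Tup k n, mu p G d t = ∑ F ∈ s.image core, ((n : ℝ) ^ k)⁻¹ *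
        ∑ H ∈ HFam F (Estar F), chiE p G (graphOf H t) := by
      intro t
      have : mu p G d t = ((n : ℝ) ^ k)⁻¹ * ∑ H ∈ s, chiE p G (graphOf H t) := by
        rw [hsdef]; rfl
      rw [this, ← Finset.mul_sum]
      congr 1
      rw [← Finset.sum_fiberwise_of_maps_to (t := s.image core) (g := core)
        (fun H hH => Finset.mem_image_of_mem _ hH)]
      refine Finset.sum_congr rfl fun F hF => ?_
      rw [aux_fiber hs d s hmem F hF]
    have hE0 : Estar ∅ = ∅ := by
      obtain ⟨_, h2, _⟩ := hs.2 ∅ ⟨∅, hg0, hce⟩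
      apply Finset.eq_empty_of_forall_notMem
      intro e he
      obtain ⟨u, v, _, hu, _⟩ := h2 e he
      simp [nonIsolated] at hu
    have h1 : ((n : ℝ) ^ k)⁻¹ *
        ∑ t : Tup k n, ∑ H ∈ HFam ∅ (Estar ∅), chiE p G (graphOf H t) = 1 := by
      rw [hE0]
      have hn' : (n : ℝ) ≠ 0 := by positivity
      simp [HFam, graphOf, chiE, hn']
    unfold muSet
    simp_rw [hmu]
    rw [Finset.sum_comm]
    simp_rw [← Finset.mul_sum]
    rw [← Finset.add_sum_erase _ _ hei, mul_add, h1]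

theorem aux_term (ε δ D n : ℝ) (k v c : ℕ) (hε : 0 < ε) (hδ : 1200 * ε < δ) (hD : 0 < D)
    (hn : 1 < n) (hk : (k : ℝ) ≤ n ^ (δ / 60)) (hDn : D ≤ 2 * Real.logb 2 n)
    (hv : (v : ℝ) ≤ ε * D) (m : ℕ) (hm : m ≤ k ^ (4 * v) * 2 ^ (v * (3 * v)))
    (hc : c ≤ v * (3 * v)) :
    0 < n ∧ (m : ℝ) * n ^ (6 * ε * v - δ * v / 10) ≤ (n ^ (-(δ / 60))) ^ v ∧
      n ^ (2 * (c : ℝ) / D - δ * v / 10) ≤ n ^ (6 * ε * v - δ * v / 10) := by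
  have hn0 : 0 < n := by linarith
  have hv0 : (0 : ℝ) ≤ v := Nat.cast_nonneg v
  have hδ0 : 0 < δ := by linarith
  refine ⟨hn0, ?_, ?_⟩
  · have h1 : (m : ℝ) ≤ (k : ℝ) ^ (4 * v) * 2 ^ (v * (3 * v)) := by exact_mod_cast hm
    have h2 : (k : ℝ) ^ (4 * v) ≤ n ^ (δ / 15 * v) := by
      calc (k : ℝ) ^ (4 * v) ≤ (n ^ (δ / 60)) ^ (4 * v) := by gcongr
        _ = n ^ (δ / 15 * v) := by
          rw [← Real.rpow_natCast, ← Real.rpow_mul hn0.le]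
          congr 1; push_cast; ring
    have h3 : (2 : ℝ) ^ (v * (3 * v)) ≤ n ^ (6 * ε * v) := by
      have : n ^ (6 * ε * v) = (2 : ℝ) ^ (Real.logb 2 n * (6 * ε * v)) := by
        rw [Real.rpow_mul (by norm_num : (0 : ℝ) ≤ 2), Real.rpow_logb (by norm_num) (by norm_num) hn0]
      rw [this, ← Real.rpow_natCast]
      apply Real.rpow_le_rpow_of_exponent_le (by norm_num)
      push_cast
      have h4 : (v : ℝ) ≤ ε * (2 * Real.logb 2 n) := hv.trans (by gcongr)
      nlinarith [mul_le_mul_of_nonneg_left h4 hv0]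
    calc (m : ℝ) * n ^ (6 * ε * v - δ * v / 10)
        ≤ (n ^ (δ / 15 * v) * n ^ (6 * ε * v)) * n ^ (6 * ε * v - δ * v / 10) := by
          gcongr
          exact h1.trans (by gcongr)
      _ = n ^ (δ / 15 * v + 6 * ε * v + (6 * ε * v - δ * v / 10)) := by
          rw [Real.rpow_add hn0, Real.rpow_add hn0]
      _ ≤ n ^ (-(δ / 60) * v) := by
          apply Real.rpow_le_rpow_of_exponent_le hn.le
          nlinarith [mul_le_mul_of_nonneg_right hδ.le hv0, mul_nonneg hδ0.le hv0]
      _ = _ := by rw [Real.rpow_mul hn0.le, Real.rpow_natCast]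
  · apply Real.rpow_le_rpow_of_exponent_le hn.le
    have h1 : (c : ℝ) ≤ v * (3 * v) := by exact_mod_cast hc
    have : 2 * (c : ℝ) / D ≤ 6 * ε * v := by
      rw [div_le_iff₀ hD]
      nlinarith [mul_le_mul_of_nonneg_left hv hv0]
    linarith

theorem measure_large_on_whole_space :
    ∃ c > (0 : ℝ), ∃ ε₀ > (0 : ℝ), ∀ ε : ℝ, 0 < ε → ε ≤ ε₀ →
      ∀ δ : ℝ, c * ε < δ →
        ∃ c' > (0 : ℝ), ∀ k n : ℕ, ∀ d D : ℝ,
          0 < d → 0 < D → d = ε * D →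
          (k : ℝ) ≤ (n : ℝ) ^ (δ / 60) → D ≤ 2 * Real.logb 2 n →
          ∀ core Estar : Finset (Sym2 (Fin k)) → Finset (Sym2 (Fin k)),
            CoreMapSpec k core Estar →
            ∀ 𝒬 : Finset (Finset (Tup k n)),
              (𝒬.card : ℝ) ≤ Real.exp ((n : ℝ) ^ (2 - δ)) →
              (Finset.univ : Finset (Tup k n)) ∈ 𝒬 →
              ∀ G ⊆ potEdges k n,
                Good ((n : ℝ) ^ (-(2 : ℝ) / D)) core Estar D δ 𝒬 G →
                1 - (n : ℝ) ^ (-c') ≤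
                  muSet ((n : ℝ) ^ (-(2 : ℝ) / D)) G d Finset.univ := by
  refine ⟨1200, by norm_num, 1 / 4, by norm_num, ?_⟩
  intro ε hε hε4 δ hδ
  refine ⟨δ / 120, by linarith, ?_⟩
  intro k n d D hd hD hdD hk hDn core Estar hs 𝒬 _ huniv G _ hgood
  have hn2 : 2 ≤ n := by
    by_contra hlt
    have : n = 0 ∨ n = 1 := by omega
    rcases this with rfl | rfl <;> simp at hDn <;> linarith
  have hn1 : (1 : ℝ) < n := by exact_mod_cast hn2
  have hn0 : (0 : ℝ) < n := by linarith
  obtain ⟨𝓕, h𝓕, hmu⟩ := aux_decomp (by omega : 0 < n) hs ((n : ℝ) ^ (-(2 : ℝ) / D)) d hd G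
  rw [hmu]
  set a : Finset (Sym2 (Fin k)) → ℝ := fun F => ((n : ℝ) ^ k)⁻¹ *
    ∑ t : Tup k n, ∑ H ∈ HFam F (Estar F),
      chiE ((n : ℝ) ^ (-(2 : ℝ) / D)) G (graphOf H t) with ha
  have hterm : ∀ F ∈ 𝓕, |a F| ≤ (n : ℝ) ^ (6 * ε * (vc F : ℝ) - δ * (vc F : ℝ) / 10) := by
    intro F hF
    obtain ⟨⟨H, hH1, hH2, hH3⟩, h2, h3, h4⟩ := h𝓕 F hF
    have hb := hgood Finset.univ huniv F ⟨H, hH1, hH2.trans (by rw [hdD]; nlinarith), hH3⟩ h2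
    unfold SBounded at hb
    have : |a F| ≤ (n : ℝ) ^ (2 * (F.card : ℝ) / D - δ * (vc F : ℝ) / 10) := by
      rw [ha]
      simp only
      rw [abs_mul, abs_of_nonneg (by positivity : (0 : ℝ) ≤ ((n : ℝ) ^ k)⁻¹)]
      exact hb
    exact this.trans (aux_term ε δ D n k (vc F) F.card hε hδ hD hn1 hk hDn (hdD ▸ h4) 0
      (Nat.zero_le _) (aux_card_le F h2 h3)).2.2
  have hsum : |∑ F ∈ 𝓕, a F| ≤ ∑ v ∈ Finset.Icc 1 ⌊d⌋₊, ((n : ℝ) ^ (-(δ / 60))) ^ v := by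
    refine (Finset.abs_sum_le_sum_abs _ _).trans ((Finset.sum_le_sum hterm).trans ?_)
    rw [← Finset.sum_fiberwise_of_maps_to (t := Finset.Icc 1 ⌊d⌋₊) (g := vc)]
    · refine Finset.sum_le_sum fun v hv => ?_
      have hvd : (v : ℝ) ≤ ε * D := by
        rw [← hdD]
        exact (Nat.le_floor_iff hd.le).1 (Finset.mem_Icc.1 hv).2
      have hcount := aux_count v (𝓕.filter fun F => vc F = v) (by
        intro F hF
        obtain ⟨hF, hv⟩ := Finset.mem_filter.1 hF
        obtain ⟨_, h2, h3, _⟩ := h𝓕 F hF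
        exact ⟨h2, h3, hv⟩)
      refine le_trans (le_of_eq ?_) (aux_term ε δ D n k v 0 hε hδ hD hn1 hk hDn hvd _
        hcount (Nat.zero_le _)).2.1
      rw [← nsmul_eq_mul, ← Finset.sum_const]
      refine Finset.sum_congr rfl fun F hF => ?_
      rw [(Finset.mem_filter.1 hF).2]
    · intro F hF
      obtain ⟨_, h2, _, h4⟩ := h𝓕 F hF
      exact Finset.mem_Icc.2 ⟨aux_vc_pos h2, Nat.le_floor h4⟩
  have hfin : ∑ v ∈ Finset.Icc 1 ⌊d⌋₊, ((n : ℝ) ^ (-(δ / 60))) ^ v ≤ (n : ℝ) ^ (-(δ / 120)) := by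
    by_cases hd1 : d < 1
    · rw [Nat.floor_eq_zero.2 hd1]
      simp
      positivity
    · push Not at hd1
      set y : ℝ := (n : ℝ) ^ (-(δ / 120)) with hy
      have hy0 : 0 < y := by positivity
      have hxy : (n : ℝ) ^ (-(δ / 60)) = y * y := by
        rw [hy, ← Real.rpow_add hn0]; congr 1; ring
      have hy2 : y ≤ 1 / 2 := by
        have : y = (2 : ℝ) ^ (Real.logb 2 n * (-(δ / 120))) := by
          rw [Real.rpow_mul (by norm_num), Real.rpow_logb (by norm_num) (by norm_num) hn0]
        rw [this]
        have h5 : (1 / 2 : ℝ) = 2 ^ (-1 : ℝ) := by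
          rw [Real.rpow_neg_one]; norm_num
        rw [h5]
        apply Real.rpow_le_rpow_of_exponent_le (by norm_num)
        have hL : 0 < Real.logb 2 n := by linarith
        have h6 : 1 ≤ ε * (2 * Real.logb 2 n) := by
          rw [hdD] at hd1
          exact hd1.trans (by gcongr)
        nlinarith [mul_le_mul_of_nonneg_right hδ.le hL.le]
      rw [hxy]
      refine (aux_geom (y * y) (by positivity) (by nlinarith) _).trans ?_
      nlinarith
  have := neg_abs_le (∑ F ∈ 𝓕, a F)
  linarith
end

section
/- For all integers k, n and reals D, δ > 0 satisfying D ≤ 2 log n and k ≤ n^{1/5}, with p = n^{−2/D}, and for any family Q ⊆ 2^T of size |Q| ≤ exp(n^{2−δ}): with probability tending to 1 as n → ∞ over G ~ G(n,k,p), for every core F ∈ F_{D/4} with A := V(E(F)), every Q ∈ Q, and every partial tuple t_A ∈ T_A, it holds that ξ_{F,Q,G_Ā}(t_A) ≤ 3·n^{k−|A|}. -/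
open Finset

/-- `G_Ā`: the graph obtained from `G` by deleting all edges with both endpoints in
`V_A = ∪_{i ∈ A} V_i`. -/
def GbarA {k n : ℕ} (A : Finset (Fin k)) (G : Finset (Sym2 (Vtx k n))) :
    Finset (Sym2 (Vtx k n)) :=
  G.filter fun e => ¬ ∀ u ∈ e, u.1 ∈ A

open Classical in
/-- The function `ξ_{F,Q,G_Ā}` evaluated at (the `A`-part of) the tuple `t`, where
`A = V(E(F))`:
`ξ_{F,Q,G_Ā}(t_A) = p^{−|E*_F|} Σ_{t_B ∈ T_B} 1[(t_A,t_B) ∈ Q] · 1[E*_F((t_A,t_B)) ⊆ G_Ā]`. -/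
noncomputable def xi {k n : ℕ} (p : ℝ) (F EstarF : Finset (Sym2 (Fin k)))
    (Q : Finset (Tup k n)) (G : Finset (Sym2 (Vtx k n))) (t : Tup k n) : ℝ :=
  (p ^ EstarF.card)⁻¹ *
    ∑ t' ∈ Finset.univ.filter (fun t' : Tup k n => ∀ i ∈ nonIsolated F, t' i = t i),
      if t' ∈ Q ∧ graphOf EstarF t' ⊆ GbarA (nonIsolated F) G then (1 : ℝ) else 0


namespace XiAux

/-- weight of a graph -/
noncomputable def wt (k n : ℕ) (p : ℝ) (G : Finset (Sym2 (Vtx k n))) : ℝ :=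
  p ^ G.card * (1 - p) ^ ((potEdges k n).card - G.card)

lemma wt_nonneg {k n : ℕ} {p : ℝ} (h0 : 0 ≤ p) (h1 : p ≤ 1) (G : Finset (Sym2 (Vtx k n))) :
    0 ≤ wt k n p G := by
  unfold wt
  have : 0 ≤ 1 - p := by linarith
  positivity

lemma sum_wt (k n : ℕ) (p : ℝ) : ∑ G ∈ (potEdges k n).powerset, wt k n p G = 1 := by
  unfold wt
  rw [Finset.sum_pow_mul_eq_add_pow]
  simp

lemma sum_wt_subset {k n : ℕ} (p : ℝ) (W : Finset (Sym2 (Vtx k n))) (hW : W ⊆ potEdges k n) :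
    ∑ G ∈ (potEdges k n).powerset, (if W ⊆ G then wt k n p G else 0) = p ^ W.card := by
  classical
  have h := Finset.prod_add (fun _ : Sym2 (Vtx k n) => p)
    (fun e => if e ∈ W then 0 else 1 - p) (potEdges k n)
  have hl : ∏ e ∈ potEdges k n, (p + if e ∈ W then 0 else 1 - p) = p ^ W.card := by
    have : ∀ e ∈ potEdges k n, (p + if e ∈ W then 0 else 1 - p) = if e ∈ W then p else 1 := by
      intro e _
      split_ifs <;> ring
    rw [Finset.prod_congr rfl this, Finset.prod_ite_mem, Finset.inter_eq_right.mpr hW]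
    simp
  rw [← hl, h]
  apply Finset.sum_congr rfl
  intro G hG
  rw [Finset.mem_powerset] at hG
  split_ifs with hWG
  · have : ∏ e ∈ potEdges k n \ G, (if e ∈ W then 0 else 1 - p)
        = ∏ e ∈ potEdges k n \ G, (1 - p) := by
      apply Finset.prod_congr rfl
      intro e he
      rw [if_neg]
      intro h
      exact (Finset.mem_sdiff.mp he).2 (hWG h)
    rw [this]
    simp [wt, Finset.card_sdiff_of_subset hG]
  · obtain ⟨e, heW, heG⟩ := Finset.not_subset.mp hWG
    rw [Finset.prod_eq_zero (i := e) (Finset.mem_sdiff.mpr ⟨hW heW, heG⟩) (by simp [heW])]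
    simp

/-- common neighbours of `W` in block `j` -/
def nb {k n : ℕ} (W : Finset (Vtx k n)) (j : Fin k) (G : Finset (Sym2 (Vtx k n))) :
    Finset (Fin n) :=
  Finset.univ.filter fun v => ∀ w ∈ W, s(w, (j, v)) ∈ G

def star {k n : ℕ} (W : Finset (Vtx k n)) (j : Fin k) (U : Finset (Fin n)) :
    Finset (Sym2 (Vtx k n)) :=
  (W ×ˢ U).image fun x => s(x.1, (j, x.2))

lemma star_subset {k n : ℕ} (W : Finset (Vtx k n)) (j : Fin k) (U : Finset (Fin n))
    (G : Finset (Sym2 (Vtx k n))) : star W j U ⊆ G ↔ U ⊆ nb W j G := by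
  constructor
  · intro h v hv
    simp only [nb, Finset.mem_filter, Finset.mem_univ, true_and]
    intro w hw
    apply h
    exact Finset.mem_image.mpr ⟨(w, v), Finset.mem_product.mpr ⟨hw, hv⟩, rfl⟩
  · intro h e he
    obtain ⟨x, hx, rfl⟩ := Finset.mem_image.mp he
    rw [Finset.mem_product] at hx
    have := h hx.2
    simp only [nb, Finset.mem_filter, Finset.mem_univ, true_and] at this
    exact this _ hx.1

lemma star_card {k n : ℕ} (W : Finset (Vtx k n)) (j : Fin k) (U : Finset (Fin n))
    (hj : ∀ w ∈ W, w.1 ≠ j) : (star W j U).card = W.card * U.card := by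
  unfold star
  rw [Finset.card_image_of_injOn, Finset.card_product]
  rintro ⟨w, v⟩ hx ⟨w', v'⟩ hy h
  simp only [Finset.coe_product, Set.mem_prod, Finset.mem_coe] at hx hy
  simp only [Sym2.eq_iff, Prod.mk.injEq] at h
  rcases h with h | h
  · obtain ⟨rfl, -, rfl⟩ := h
    rfl
  · exact absurd (by rw [h.1]) (hj w hx.1)

lemma star_pot {k n : ℕ} (W : Finset (Vtx k n)) (j : Fin k) (U : Finset (Fin n))
    (hj : ∀ w ∈ W, w.1 ≠ j) : star W j U ⊆ potEdges k n := by
  intro e he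
  obtain ⟨x, hx, rfl⟩ := Finset.mem_image.mp he
  rw [Finset.mem_product] at hx
  simp only [potEdges, Finset.mem_filter, Finset.mem_univ, true_and, Sym2.map_mk,
    Sym2.mk_isDiag_iff]
  exact hj _ hx.1

lemma mgf {k n : ℕ} (p l : ℝ) (W : Finset (Vtx k n)) (j : Fin k)
    (hj : ∀ w ∈ W, w.1 ≠ j) :
    ∑ G ∈ (potEdges k n).powerset, wt k n p G * (1 + l) ^ (nb W j G).card
      = (1 + l * p ^ W.card) ^ n := by
  classical
  have h1 : ∀ G : Finset (Sym2 (Vtx k n)), (1 + l) ^ (nb W j G).card =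
      ∑ U ∈ (Finset.univ : Finset (Fin n)).powerset,
        if star W j U ⊆ G then l ^ U.card else 0 := by
    intro G
    have := Finset.sum_pow_mul_eq_add_pow l 1 (nb W j G)
    rw [add_comm, ← this, ← Finset.sum_filter]
    simp only [one_pow, mul_one]
    apply Finset.sum_congr _ (fun _ _ => rfl)
    ext U
    simp [star_subset]
  simp_rw [h1, Finset.mul_sum]
  rw [Finset.sum_comm]
  have h2 : ∀ U ∈ (Finset.univ : Finset (Fin n)).powerset,
      ∑ G ∈ (potEdges k n).powerset, wt k n p G * (if star W j U ⊆ G then l ^ U.card else 0)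
      = (l * p ^ W.card) ^ U.card * 1 ^ (n - U.card) := by
    intro U _
    have := sum_wt_subset p (star W j U) (star_pot W j U hj)
    rw [star_card W j U hj, pow_mul] at this
    rw [mul_pow, one_pow, mul_one, ← this, Finset.mul_sum]
    apply Finset.sum_congr rfl
    intro G _
    split_ifs <;> ring
  rw [Finset.sum_congr rfl h2]
  have := Finset.sum_pow_mul_eq_add_pow (l * p ^ W.card) 1 (Finset.univ : Finset (Fin n))
  simp only [Finset.card_univ, Fintype.card_fin] at this
  rw [this, add_comm]

open Classical in
lemma tail {k n : ℕ} {p l : ℝ} (h0 : 0 ≤ p) (h1 : p ≤ 1) (hl0 : 0 ≤ l) (hl1 : l ≤ 1)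
    (W : Finset (Vtx k n)) (j : Fin k) (hj : ∀ w ∈ W, w.1 ≠ j) :
    ∑ G ∈ (potEdges k n).powerset,
      (if (1 + l) * (n * p ^ W.card) < ((nb W j G).card : ℝ) then wt k n p G else 0)
      ≤ Real.exp (-(l ^ 2 / 3 * (n * p ^ W.card))) := by
  set m : ℝ := n * p ^ W.card with hm
  have hm0 : 0 ≤ m := by positivity
  have hlog : l + l ^ 2 / 3 ≤ (1 + l) * Real.log (1 + l) := by
    have := Real.le_log_one_add_of_nonneg hl0
    have h2 : l + l ^ 2 / 3 ≤ (1 + l) * (2 * l / (l + 2)) := by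
      rw [mul_div_assoc', le_div_iff₀ (by linarith)]
      nlinarith [mul_nonneg (mul_nonneg hl0 hl0) (sub_nonneg.mpr hl1)]
    exact h2.trans (mul_le_mul_of_nonneg_left this (by linarith))
  have hbd : ∀ G ∈ (potEdges k n).powerset,
      (if (1 + l) * m < ((nb W j G).card : ℝ) then wt k n p G else 0)
      ≤ Real.exp (-((1 + l) * m * Real.log (1 + l))) *
        (wt k n p G * (1 + l) ^ (nb W j G).card) := by
    intro G _
    have hw := wt_nonneg (k := k) (n := n) h0 h1 G
    split_ifs with h
    · have h3 : (1 + l) ^ (nb W j G).card = Real.exp ((nb W j G).card * Real.log (1 + l)) := by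
        rw [Real.exp_nat_mul, Real.exp_log (by linarith)]
      rw [h3]
      have h4 : 1 ≤ Real.exp (-((1 + l) * m * Real.log (1 + l))) *
          Real.exp ((nb W j G).card * Real.log (1 + l)) := by
        rw [← Real.exp_add]
        apply Real.one_le_exp
        have := mul_le_mul_of_nonneg_right h.le (Real.log_nonneg (by linarith : 1 ≤ 1 + l))
        linarith
      nlinarith
    · positivity
  refine (Finset.sum_le_sum hbd).trans ?_
  rw [← Finset.mul_sum, mgf p l W j hj]
  have h5 : (1 + l * p ^ W.card) ^ n ≤ Real.exp (l * m) := by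
    have : 1 + l * p ^ W.card ≤ Real.exp (l * p ^ W.card) := by
      rw [add_comm]; exact Real.add_one_le_exp _
    calc _ ≤ (Real.exp (l * p ^ W.card)) ^ n := by gcongr
      _ = _ := by rw [← Real.exp_nat_mul, hm]; congr 1; ring
  calc _ ≤ Real.exp (-((1 + l) * m * Real.log (1 + l))) * Real.exp (l * m) := by gcongr
    _ = Real.exp (-((1 + l) * m * Real.log (1 + l)) + l * m) := (Real.exp_add _ _).symm
    _ ≤ _ := by
      apply Real.exp_le_exp.mpr
      nlinarith [mul_le_mul_of_nonneg_right hlog hm0]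

lemma vc_exists {k : ℕ} (H : Finset (Sym2 (Fin k))) (hH : IsGraph H) :
    ∃ S : Finset (Fin k), S.card = vc H ∧ IsCover H S := by
  have : {m | ∃ S : Finset (Fin k), S.card = m ∧ IsCover H S}.Nonempty := by
    refine ⟨_, Finset.univ, rfl, ?_⟩
    intro e _
    induction e using Sym2.ind with
    | _ x y => exact ⟨x, Finset.mem_univ _, by simp⟩
  exact Nat.sInf_mem this

lemma vc_le {k : ℕ} (H : Finset (Sym2 (Fin k))) (S : Finset (Fin k)) (h : IsCover H S) :
    vc H ≤ S.card := Nat.sInf_le ⟨S, rfl, h⟩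

/-- neighbours of `j` in an edge set -/
def nbr {k : ℕ} (E : Finset (Sym2 (Fin k))) (j : Fin k) : Finset (Fin k) :=
  Finset.univ.filter fun u => s(u, j) ∈ E

lemma nbr_card {k : ℕ} {core Estar : Finset (Sym2 (Fin k)) → Finset (Sym2 (Fin k))}
    (hc : CoreMapSpec k core Estar) {d : ℝ} {F : Finset (Sym2 (Fin k))}
    (hF : F ∈ coreSet core d) (j : Fin k) (hj : j ∉ nonIsolated F) :
    ((nbr (Estar F) j).card : ℝ) ≤ d := by
  obtain ⟨H, hH, hvc, hcF⟩ := hF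
  have hcore := hc.1 H hH
  rw [hcF] at hcore
  obtain ⟨_, hE, hiff⟩ := hc.2 F ⟨H, hH, hcF⟩
  have hFH : F ⊆ H := by
    obtain ⟨S, hS⟩ := hcore.1
    exact fun e he => ((hS e).mp he).1
  have hFg : IsGraph F := fun e he => hH e (hFH he)
  have hvcF : vc F ≤ vc H := by
    obtain ⟨S, hS, hcov⟩ := vc_exists H hH
    rw [← hS]
    exact vc_le F S (fun e he => hcov e (hFH he))
  have hdisj : Disjoint F (Estar F) := by
    rw [Finset.disjoint_left]
    intro e he he'
    obtain ⟨u, v, rfl, hu, hv⟩ := hE e he'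
    apply hv
    simp only [nonIsolated, Finset.mem_filter, Finset.mem_univ, true_and]
    exact ⟨_, he, by simp⟩
  have hg2 : IsGraph (F ∪ Estar F) := by
    intro e he
    rcases Finset.mem_union.mp he with h | h
    · exact hFg e h
    · obtain ⟨u, v, rfl, hu, hv⟩ := hE e h
      rw [Sym2.mk_isDiag_iff]
      rintro rfl
      exact hv hu
  have hc2 : core (F ∪ Estar F) = F :=
    (hiff _ hg2).mpr ⟨Estar F, Finset.Subset.refl _, hdisj, rfl⟩
  have hcore2 := hc.1 _ hg2
  rw [hc2] at hcore2
  obtain ⟨S, hS, hcov⟩ := vc_exists F hFg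
  have hcov' : IsCover F (S ∩ nonIsolated F) := by
    intro e he
    obtain ⟨v, hv, hve⟩ := hcov e he
    refine ⟨v, Finset.mem_inter.mpr ⟨hv, ?_⟩, hve⟩
    simp only [nonIsolated, Finset.mem_filter, Finset.mem_univ, true_and]
    exact ⟨e, he, hve⟩
  have hcard : (S ∩ nonIsolated F).card = vc F :=
    le_antisymm (hS ▸ Finset.card_le_card Finset.inter_subset_left) (vc_le _ _ hcov')
  have hcov2 := hcore2.2 _ hcov' hcard
  have hsub : nbr (Estar F) j ⊆ S ∩ nonIsolated F := by
    intro u hu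
    simp only [nbr, Finset.mem_filter, Finset.mem_univ, true_and] at hu
    obtain ⟨v, hv, hve⟩ := hcov2 _ (Finset.mem_union_right _ hu)
    rw [Sym2.mem_iff] at hve
    rcases hve with rfl | rfl
    · exact hv
    · exact absurd (Finset.mem_inter.mp hv).2 hj
  have := Finset.card_le_card hsub
  have h3 : (nbr (Estar F) j).card ≤ vc H := by omega
  have h4 : ((nbr (Estar F) j).card : ℝ) ≤ vc H := by exact_mod_cast h3
  linarith

lemma xi_le {k n : ℕ} {p l d : ℝ} (hp0 : 0 < p) (hp1 : p ≤ 1) (hl : l = 1 / (k : ℝ))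
    (hn : 1 ≤ n) (G : Finset (Sym2 (Vtx k n)))
    (hG : ∀ (W : Finset (Vtx k n)) (j : Fin k), (∀ w ∈ W, w.1 ≠ j) → (W.card : ℝ) ≤ d →
      ((nb W j G).card : ℝ) ≤ (1 + l) * (n * p ^ W.card))
    {core Estar : Finset (Sym2 (Fin k)) → Finset (Sym2 (Fin k))}
    (hc : CoreMapSpec k core Estar) {F : Finset (Sym2 (Fin k))}
    (hF : F ∈ coreSet core d) (Q : Finset (Tup k n)) (t : Tup k n) :
    xi p F (Estar F) Q G t ≤ 3 * (n : ℝ) ^ ((k : ℝ) - ((nonIsolated F).card : ℝ)) := by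
  classical
  set A := nonIsolated F with hA
  have hE : ∀ e ∈ Estar F, ∃ u v, e = s(u, v) ∧ u ∈ nonIsolated F ∧ v ∉ nonIsolated F := by
    obtain ⟨H, hH, hvc, hcF⟩ := hF
    exact (hc.2 F ⟨H, hH, hcF⟩).2.1
  let W : Fin k → Finset (Vtx k n) := fun j => (nbr (Estar F) j).image fun u => (u, t u)
  have hWcard : ∀ j, (W j).card = (nbr (Estar F) j).card := by
    intro j
    apply Finset.card_image_of_injective
    intro a b h
    exact (Prod.mk.inj h).1
  have hWj : ∀ j, j ∉ A → ∀ w ∈ W j, w.1 ≠ j := by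
    intro j hj w hw
    obtain ⟨u, hu, rfl⟩ := Finset.mem_image.mp hw
    simp only [nbr, Finset.mem_filter, Finset.mem_univ, true_and] at hu
    obtain ⟨a, b, hab, ha, hb⟩ := hE _ hu
    rintro rfl
    have : (s(u, u) : Sym2 (Fin k)).IsDiag := by simp
    rw [hab, Sym2.mk_isDiag_iff] at this
    exact hb (this ▸ ha)
  have hX : ∀ j ∈ Aᶜ, ((nb (W j) j G).card : ℝ) ≤ (1 + l) * (n * p ^ (W j).card) := by
    intro j hj
    rw [Finset.mem_compl] at hj
    apply hG _ _ (hWj j hj)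
    rw [hWcard]
    exact nbr_card hc hF j hj
  have hEcard : (Estar F).card ≤ ∑ j ∈ Aᶜ, (W j).card := by
    have hsub : Estar F ⊆ (Aᶜ).biUnion fun j => (nbr (Estar F) j).image fun u => s(u, j) := by
      intro e he
      obtain ⟨u, v, rfl, hu, hv⟩ := hE e he
      simp only [Finset.mem_biUnion, Finset.mem_compl, Finset.mem_image]
      exact ⟨v, hv, u, by simpa [nbr] using he, rfl⟩
    refine (Finset.card_le_card hsub).trans (Finset.card_biUnion_le.trans ?_)
    apply Finset.sum_le_sum
    intro j _
    rw [hWcard]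
    exact Finset.card_image_le
  have hcount : (∑ t' ∈ Finset.univ.filter (fun t' : Tup k n => ∀ i ∈ A, t' i = t i),
      if t' ∈ Q ∧ graphOf (Estar F) t' ⊆ GbarA A G then (1 : ℝ) else 0)
      ≤ ∏ j ∈ Aᶜ, ((nb (W j) j G).card : ℝ) := by
    rw [← Finset.sum_filter, Finset.sum_const, nsmul_eq_mul, mul_one]
    have hsub : (Finset.univ.filter (fun t' : Tup k n => ∀ i ∈ A, t' i = t i)).filter
        (fun t' => t' ∈ Q ∧ graphOf (Estar F) t' ⊆ GbarA A G) ⊆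
        Fintype.piFinset (fun j => if j ∈ A then {t j} else nb (W j) j G) := by
      intro t' ht'
      simp only [Finset.mem_filter, Finset.mem_univ, true_and] at ht'
      rw [Fintype.mem_piFinset]
      intro j
      split_ifs with hj
      · simp [ht'.1 j hj]
      · simp only [nb, Finset.mem_filter, Finset.mem_univ, true_and]
        intro w hw
        obtain ⟨u, hu, rfl⟩ := Finset.mem_image.mp hw
        simp only [nbr, Finset.mem_filter, Finset.mem_univ, true_and] at hu
        have huA : u ∈ A := by
          obtain ⟨a, b, hab, ha, hb⟩ := hE _ hu
          rw [Sym2.eq_iff] at hab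
          rcases hab with ⟨rfl, rfl⟩ | ⟨rfl, rfl⟩
          · exact ha
          · exact absurd ha hj
        rw [← ht'.1 u huA]
        have hm : s((u, t' u), (j, t' j)) ∈ graphOf (Estar F) t' :=
          Finset.mem_image.mpr ⟨_, hu, by simp⟩
        exact (Finset.mem_filter.mp (ht'.2.2 hm)).1
    have := Finset.card_le_card hsub
    rw [Fintype.card_piFinset] at this
    have h2 : ∏ j : Fin k, (if j ∈ A then ({t j} : Finset (Fin n)) else nb (W j) j G).card
        = ∏ j ∈ Aᶜ, (nb (W j) j G).card := by
      rw [← Finset.prod_mul_prod_compl A, Finset.prod_eq_one, one_mul]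
      · apply Finset.prod_congr rfl
        intro j hj
        rw [if_neg (Finset.mem_compl.mp hj)]
      · intro j hj
        simp [hj]
    rw [h2] at this
    exact_mod_cast this
  have hl0 : 0 ≤ l := by rw [hl]; positivity
  have hBk : (Aᶜ).card ≤ k := by simpa using Finset.card_le_univ (Aᶜ)
  have hAk : A.card + (Aᶜ).card = k := by simpa using Finset.card_add_card_compl A
  have hprod : ∏ j ∈ Aᶜ, ((nb (W j) j G).card : ℝ) ≤
      p ^ (Estar F).card * (3 * (n : ℝ) ^ (Aᶜ).card) := by
    calc _ ≤ ∏ j ∈ Aᶜ, ((1 + l) * (n * p ^ (W j).card)) :=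
          Finset.prod_le_prod (fun _ _ => by positivity) hX
      _ = p ^ (∑ j ∈ Aᶜ, (W j).card) * ((1 + l) ^ (Aᶜ).card * (n : ℝ) ^ (Aᶜ).card) := by
          rw [Finset.prod_mul_distrib, Finset.prod_mul_distrib, Finset.prod_pow_eq_pow_sum]
          simp only [Finset.prod_const]
          ring
      _ ≤ _ := by
          have h1 : p ^ (∑ j ∈ Aᶜ, (W j).card) ≤ p ^ (Estar F).card :=
            pow_le_pow_of_le_one hp0.le hp1 hEcard
          have h2 : (1 + l) ^ (Aᶜ).card ≤ 3 := by
            calc (1 + l) ^ (Aᶜ).card ≤ (1 + l) ^ k :=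
                  pow_le_pow_right₀ (by linarith) hBk
              _ ≤ (Real.exp l) ^ k := by
                  gcongr
                  rw [add_comm]; exact Real.add_one_le_exp _
              _ = Real.exp (k * l) := (Real.exp_nat_mul _ _).symm
              _ ≤ Real.exp 1 := by
                  apply Real.exp_le_exp.mpr
                  rw [hl, mul_one_div]
                  exact div_self_le_one _
              _ ≤ 3 := by linarith [Real.exp_one_lt_d9]
          gcongr
  have hpow : (n : ℝ) ^ ((k : ℝ) - (A.card : ℝ)) = (n : ℝ) ^ (Aᶜ).card := by
    rw [← Real.rpow_natCast]
    congr 1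
    have hAk' : (A.card : ℝ) + ((Aᶜ).card : ℝ) = (k : ℝ) := by exact_mod_cast hAk
    linarith
  rw [hpow]
  unfold xi
  have hpp : 0 < p ^ (Estar F).card := by positivity
  rw [inv_mul_le_iff₀ hpp]
  refine le_trans (le_of_eq ?_) (hcount.trans hprod)
  rfl

lemma card_small {α : Type*} [Fintype α] [DecidableEq α] (N m : ℕ) (hN : Fintype.card α ≤ N)
    (hN1 : 1 ≤ N) :
    (Finset.univ.filter fun W : Finset α => W.card ≤ m).card ≤ (m + 1) * N ^ m := by
  have hsub : (Finset.univ.filter fun W : Finset α => W.card ≤ m) ⊆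
      (Finset.range (m + 1)).biUnion fun i => Finset.powersetCard i Finset.univ := by
    intro W hW
    simp only [Finset.mem_filter, Finset.mem_univ, true_and] at hW
    simp only [Finset.mem_biUnion, Finset.mem_range, Finset.mem_powersetCard]
    exact ⟨W.card, by omega, Finset.subset_univ _, rfl⟩
  refine (Finset.card_le_card hsub).trans (Finset.card_biUnion_le.trans ?_)
  calc _ ≤ ∑ i ∈ Finset.range (m + 1), N ^ m := by
        apply Finset.sum_le_sum
        intro i hi
        rw [Finset.card_powersetCard, Finset.card_univ]
        have hi' : i ≤ m := by rw [Finset.mem_range] at hi; omega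
        calc _ ≤ (Fintype.card α) ^ i := Nat.choose_le_pow _ _
          _ ≤ N ^ i := Nat.pow_le_pow_left hN i
          _ ≤ N ^ m := Nat.pow_le_pow_right hN1 hi'
    _ = _ := by simp

open Classical in
lemma prob_ge {k n : ℕ} {p : ℝ} (h0 : 0 ≤ p) (h1 : p ≤ 1)
    (P : Finset (Sym2 (Vtx k n)) → Prop) {ι : Type*} (I : Finset ι)
    (bad : ι → Finset (Sym2 (Vtx k n)) → Prop) (b : ℝ)
    (hP : ∀ G, (∀ i ∈ I, ¬ bad i G) → P G)
    (hb : ∀ i ∈ I, ∑ G ∈ (potEdges k n).powerset, (if bad i G then wt k n p G else 0) ≤ b) :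
    1 - I.card * b ≤ probG k n p P := by
  have hs : ∑ i ∈ I, ∑ G ∈ (potEdges k n).powerset, (if bad i G then wt k n p G else 0)
      ≤ I.card * b := by
    have := Finset.sum_le_card_nsmul I _ b hb
    simpa using this
  have hkey : (1 : ℝ) ≤ probG k n p P +
      ∑ i ∈ I, ∑ G ∈ (potEdges k n).powerset, (if bad i G then wt k n p G else 0) := by
    rw [← sum_wt k n p, Finset.sum_comm, probG, ← Finset.sum_add_distrib]
    apply Finset.sum_le_sum
    intro G _
    have hw := wt_nonneg (k := k) (n := n) h0 h1 G
    have hnn : ∀ i ∈ I, 0 ≤ (if bad i G then wt k n p G else 0) := by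
      intro i _
      split_ifs <;> simp [hw]
    by_cases hPG : P G
    · rw [if_pos hPG]
      have := Finset.sum_nonneg hnn
      change wt k n p G ≤ wt k n p G + _
      linarith
    · rw [if_neg hPG, zero_add]
      have : ∃ i ∈ I, bad i G := by
        by_contra hcon
        push Not at hcon
        exact hPG (hP G hcon)
      obtain ⟨i, hi, hbi⟩ := this
      have := Finset.single_le_sum hnn hi
      rwa [if_pos hbi] at this
  linarith

lemma asymp (γ : ℝ) (hγ : 0 < γ) : ∃ n₀ : ℕ, ∀ n ≥ n₀, 2 ≤ n ∧
    Real.exp ((Real.log n) ^ 2 / Real.log 2 + 2 * Real.log n) *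
      Real.exp (-((n : ℝ) ^ ((1 : ℝ) / 10) / 3)) ≤ γ := by
  have hl : Filter.Tendsto (fun x : ℝ => x ^ ((1 : ℝ) / 10) / 3 -
      ((Real.log x) ^ 2 / Real.log 2 + 2 * Real.log x)) Filter.atTop Filter.atTop := by
    have h1 : (fun x : ℝ => (Real.log x) ^ 2) =o[Filter.atTop] fun x => x ^ ((1 : ℝ) / 10) := by
      simpa using isLittleO_log_rpow_rpow_atTop (s := (1 : ℝ) / 10) 2 (by norm_num)
    have h2 : (fun x : ℝ => Real.log x) =o[Filter.atTop] fun x => x ^ ((1 : ℝ) / 10) :=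
      isLittleO_log_rpow_atTop (by norm_num)
    have h3 : (fun x : ℝ => (Real.log x) ^ 2 / Real.log 2 + 2 * Real.log x)
        =o[Filter.atTop] fun x => x ^ ((1 : ℝ) / 10) := by
      apply Asymptotics.IsLittleO.add
      · simpa [div_eq_inv_mul] using h1.const_mul_left (Real.log 2)⁻¹
      · exact h2.const_mul_left 2
    have h4 := h3.def (c := 1 / 6) (by norm_num)
    have h5 : Filter.Tendsto (fun x : ℝ => x ^ ((1 : ℝ) / 10) / 6) Filter.atTop Filter.atTop :=
      (tendsto_rpow_atTop (by norm_num : (0 : ℝ) < 1 / 10)).atTop_div_const (by norm_num)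
    refine Filter.tendsto_atTop_mono' _ ?_ h5
    filter_upwards [h4, Filter.eventually_ge_atTop 0] with x hx hx0
    rw [Real.norm_eq_abs, Real.norm_of_nonneg (Real.rpow_nonneg hx0 _)] at hx
    have := (abs_le.mp hx).2
    linarith
  have hl2 := hl.comp tendsto_natCast_atTop_atTop (α := ℕ)
  have := (hl2.eventually_ge_atTop (-Real.log γ)).and (Filter.eventually_ge_atTop 2)
  obtain ⟨n₀, hn₀⟩ := Filter.eventually_atTop.mp this
  refine ⟨n₀, fun n hn => ⟨(hn₀ n hn).2, ?_⟩⟩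
  have h6 := (hn₀ n hn).1
  simp only [Function.comp] at h6
  rw [← Real.exp_add, ← Real.le_log_iff_exp_le hγ]
  linarith

lemma card_bound {n m : ℕ} {D : ℝ} (hn : 2 ≤ n) (hm : (m : ℝ) ≤ D / 4)
    (hD : D ≤ 2 * Real.logb 2 n) (k : ℕ) (hk : k ≤ n) :
    (((m + 1) * (n * n) ^ m * k : ℕ) : ℝ) ≤
      Real.exp ((Real.log n) ^ 2 / Real.log 2 + 2 * Real.log n) := by
  have hn0 : (0 : ℝ) < n := by positivity
  have hL2 : 0 < Real.log 2 := Real.log_pos (by norm_num)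
  have hL : 0 ≤ Real.log n := Real.log_nonneg (by exact_mod_cast (by omega : 1 ≤ n))
  have h2m : 2 * (m : ℝ) ≤ Real.log n / Real.log 2 := by
    rw [Real.logb] at hD
    linarith
  have hmn : m + 1 ≤ n := by
    have h1 : (m : ℝ) * Real.log 2 ≤ Real.log n := by
      rw [le_div_iff₀ hL2] at h2m
      have : 0 ≤ (m : ℝ) * Real.log 2 := by positivity
      linarith
    have h2 : (2 : ℝ) ^ m ≤ n := by
      rw [← Real.log_le_log_iff (by positivity) hn0, Real.log_pow]
      exact h1
    have h3 : 2 ^ m ≤ n := by exact_mod_cast h2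
    exact Nat.lt_two_pow_self.trans_le h3
  have h1 : (m + 1) * (n * n) ^ m * k ≤ n ^ (2 * m + 2) := by
    calc _ ≤ n * (n * n) ^ m * n := by gcongr
      _ = _ := by rw [← sq, ← pow_mul]; ring
  calc _ ≤ ((n ^ (2 * m + 2) : ℕ) : ℝ) := by exact_mod_cast h1
    _ = Real.exp ((2 * m + 2 : ℕ) * Real.log n) := by
        rw [Real.exp_nat_mul, Real.exp_log hn0]; push_cast; rfl
    _ ≤ _ := by
        apply Real.exp_le_exp.mpr
        have := mul_le_mul_of_nonneg_right h2m hL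
        push_cast
        have e : Real.log n / Real.log 2 * Real.log n = Real.log n ^ 2 / Real.log 2 := by ring
        linarith

lemma exp_bound {n k d : ℕ} {D : ℝ} (hn : 2 ≤ n) (hD0 : 0 < D) (hd : (d : ℝ) ≤ D / 4)
    (hk0 : 0 < k) (hk : (k : ℝ) ≤ (n : ℝ) ^ ((1 : ℝ) / 5)) :
    (n : ℝ) ^ ((1 : ℝ) / 10) / 3 ≤
      (1 / (k : ℝ)) ^ 2 / 3 * (n * ((n : ℝ) ^ (-(2 : ℝ) / D)) ^ d) := by
  have hn0 : (0 : ℝ) < n := by positivity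
  have hn1 : (1 : ℝ) ≤ n := by exact_mod_cast (by omega : 1 ≤ n)
  have hk0' : (0 : ℝ) < k := by exact_mod_cast hk0
  have h1 : (n : ℝ) ^ (-(1 : ℝ) / 2) ≤ ((n : ℝ) ^ (-(2 : ℝ) / D)) ^ d := by
    rw [← Real.rpow_natCast, ← Real.rpow_mul hn0.le]
    apply Real.rpow_le_rpow_of_exponent_le hn1
    rw [div_mul_eq_mul_div, le_div_iff₀ hD0]
    linarith
  have h2 : (n : ℝ) ^ (-(2 : ℝ) / 5) ≤ (1 / (k : ℝ)) ^ 2 := by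
    rw [one_div, inv_pow]
    have : (k : ℝ) ^ 2 ≤ (n : ℝ) ^ ((2 : ℝ) / 5) := by
      calc (k : ℝ) ^ 2 ≤ ((n : ℝ) ^ ((1 : ℝ) / 5)) ^ 2 := by gcongr
        _ = _ := by rw [← Real.rpow_natCast, ← Real.rpow_mul hn0.le]; norm_num
    rw [neg_div, Real.rpow_neg hn0.le]
    exact inv_anti₀ (by positivity) this
  have h3 : (n : ℝ) ^ ((1 : ℝ) / 10) =
      (n : ℝ) ^ (-(2 : ℝ) / 5) * (n * (n : ℝ) ^ (-(1 : ℝ) / 2)) := by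
    nth_rewrite 3 [← Real.rpow_one (n : ℝ)]
    rw [← Real.rpow_add hn0, ← Real.rpow_add hn0]
    norm_num
  rw [h3, div_mul_eq_mul_div]
  gcongr

end XiAux

/-- Claim 5.10: for all integers `k, n` and reals `D, δ > 0` with
`D ≤ 2 log n` and `k ≤ n^{1/5}`, `p = n^{−2/D}`, and any family `𝒬 ⊆ 2^T` with
`|𝒬| ≤ exp(n^{2−δ})`: asymptotically almost surely over `G ∼ G(n,k,p)`, for every
core `F ∈ F_{D/4}` with `A := V(E(F))`, every `Q ∈ 𝒬` and every partial tuple `t_A`,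
`ξ_{F,Q,G_Ā}(t_A) ≤ 3·n^{k−|A|}`. -/
theorem xi_is_bounded :
    ∀ γ > (0 : ℝ), ∃ n₀ : ℕ, ∀ n ≥ n₀, ∀ k : ℕ, ∀ D δ : ℝ,
      0 < D → 0 < δ → D ≤ 2 * Real.logb 2 n → (k : ℝ) ≤ (n : ℝ) ^ ((1 : ℝ) / 5) →
      ∀ core Estar : Finset (Sym2 (Fin k)) → Finset (Sym2 (Fin k)),
        CoreMapSpec k core Estar →
        ∀ 𝒬 : Finset (Finset (Tup k n)),
          (𝒬.card : ℝ) ≤ Real.exp ((n : ℝ) ^ (2 - δ)) →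
          1 - γ ≤
            probG k n ((n : ℝ) ^ (-(2 : ℝ) / D)) (fun G =>
              ∀ F ∈ coreSet core (D / 4), ∀ Q ∈ 𝒬, ∀ t : Tup k n,
                xi ((n : ℝ) ^ (-(2 : ℝ) / D)) F (Estar F) Q G t ≤
                  3 * (n : ℝ) ^ ((k : ℝ) - ((nonIsolated F).card : ℝ))) := by
  intro γ hγ
  obtain ⟨n₀, hn₀⟩ := XiAux.asymp γ hγ
  refine ⟨n₀, fun n hn k D δ hD0 _ hD hk core Estar hc 𝒬 _ => ?_⟩
  obtain ⟨hn2, hfin⟩ := hn₀ n hn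
  have hn1 : (1 : ℝ) ≤ n := by exact_mod_cast (by omega : 1 ≤ n)
  have hn0 : (0 : ℝ) < n := by linarith
  have hkn : k ≤ n := by
    have : (n : ℝ) ^ ((1 : ℝ) / 5) ≤ (n : ℝ) ^ (1 : ℝ) :=
      Real.rpow_le_rpow_of_exponent_le hn1 (by norm_num)
    rw [Real.rpow_one] at this
    exact_mod_cast hk.trans this
  set p : ℝ := (n : ℝ) ^ (-(2 : ℝ) / D) with hp
  have hp0 : 0 < p := Real.rpow_pos_of_pos hn0 _
  have hp1 : p ≤ 1 := by
    apply Real.rpow_le_one_of_one_le_of_nonpos hn1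
    rw [neg_div]
    have : 0 < 2 / D := by positivity
    linarith
  let m : ℕ := ⌊D / 4⌋₊
  have hm : (m : ℝ) ≤ D / 4 := Nat.floor_le (by positivity)
  let l : ℝ := 1 / (k : ℝ)
  let I0 : Finset (Finset (Vtx k n) × Fin k) :=
    (Finset.univ.filter fun W : Finset (Vtx k n) => W.card ≤ m) ×ˢ Finset.univ
  let I : Finset (Finset (Vtx k n) × Fin k) := I0.filter fun x => ∀ w ∈ x.1, w.1 ≠ x.2
  have hIcard : I.card ≤ (m + 1) * (n * n) ^ m * k := by
    refine (Finset.card_filter_le _ _).trans ?_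
    rw [Finset.card_product]
    have hc1 : Fintype.card (Vtx k n) ≤ n * n := by
      simp only [Fintype.card_prod, Fintype.card_fin]
      exact Nat.mul_le_mul_right _ hkn
    have := XiAux.card_small (α := Vtx k n) (n * n) m hc1 (by nlinarith)
    simp only [Finset.card_univ, Fintype.card_fin]
    exact Nat.mul_le_mul_right _ this
  have key := XiAux.prob_ge (k := k) (n := n) hp0.le hp1 (fun G =>
              ∀ F ∈ coreSet core (D / 4), ∀ Q ∈ 𝒬, ∀ t : Tup k n,
                xi p F (Estar F) Q G t ≤
                  3 * (n : ℝ) ^ ((k : ℝ) - ((nonIsolated F).card : ℝ))) I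
      (fun x G => (1 + l) * (n * p ^ x.1.card) < ((XiAux.nb x.1 x.2 G).card : ℝ))
      (Real.exp (-((n : ℝ) ^ ((1 : ℝ) / 10) / 3)))
      (by
        intro G hG F hF Q _ t
        refine XiAux.xi_le hp0 hp1 (l := l) (d := D / 4) rfl (by omega) G ?_ hc hF Q t
        intro W j hj hW
        have hmem : (W, j) ∈ I := by
          simp only [I, I0, Finset.mem_filter, Finset.mem_product, Finset.mem_univ, true_and,
            and_true]
          exact ⟨Nat.le_floor hW, hj⟩
        exact not_lt.mp (hG _ hmem))
      (by
        rintro ⟨W, j⟩ hx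
        simp only [I, I0, Finset.mem_filter, Finset.mem_product, Finset.mem_univ, true_and,
            and_true] at hx
        have hk0 : 0 < k := j.pos
        have hk1 : (1 : ℝ) ≤ k := by exact_mod_cast hk0
        have hW : (W.card : ℝ) ≤ D / 4 := le_trans (by exact_mod_cast hx.1) hm
        refine (XiAux.tail hp0.le hp1 (l := l) (by positivity) ?_ W j hx.2).trans ?_
        · exact (div_le_one (by linarith)).mpr hk1
        · apply Real.exp_le_exp.mpr
          apply neg_le_neg
          exact XiAux.exp_bound hn2 hD0 hW hk0 hk)
  refine le_trans ?_ key
  have hcb := XiAux.card_bound hn2 hm hD k hkn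
  have hI2 : (I.card : ℝ) ≤ Real.exp ((Real.log n) ^ 2 / Real.log 2 + 2 * Real.log n) :=
    le_trans (by exact_mod_cast hIcard) hcb
  have := mul_le_mul_of_nonneg_right hI2 (Real.exp_pos (-((n : ℝ) ^ ((1 : ℝ) / 10) / 3))).le
  linarith
end

section
/- The family of Tseitin contradictions is simple: there is a sequence F = (F_n : n ∈ ℕ) of families of n-variate Boolean functions with |F_n| ≤ 2^{O(n·log n)} such that for every n, every Tseitin contradiction Tseitin(G,α) over n variables has a tree-like sem(F) refutation of length polynomial in the size of Tseitin(G,α). -/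
/-- A Boolean function on `N` variables, viewed as the indicator of the set of
assignments it rules out. -/
abbrev BFunc (N : ℕ) := (Fin N → Bool) → Bool

/-- A clause over `N` Boolean variables: a disjunction of literals over distinct
variables, recorded by the polarity (if any) of each variable. -/
abbrev Clause (N : ℕ) := Fin N → Option Bool

/-- The assignment `α` satisfies the clause `c`. -/
def clauseSat {N : ℕ} (c : Clause N) (α : Fin N → Bool) : Prop :=
  ∃ i b, c i = some b ∧ α i = b

/-- The indicator of the falsifying assignments of the clause `c`. -/
def falsInd {N : ℕ} (c : Clause N) : BFunc N :=
  fun α => decide (∀ i b, c i = some b → α i ≠ b)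

/-- A tree-like semantic proof: a tree each of whose nodes is labelled with a Boolean
function and has at most two children. -/
inductive SemProof (N : ℕ) : Type
  | leaf : BFunc N → SemProof N
  | node1 : BFunc N → SemProof N → SemProof N
  | node2 : BFunc N → SemProof N → SemProof N → SemProof N

namespace SemProof

/-- The function labelling the root. -/
def root {N : ℕ} : SemProof N → BFunc N
  | leaf f => f
  | node1 f _ => f
  | node2 f _ _ => f

/-- The length of a tree-like proof: its number of lines. -/
def length {N : ℕ} : SemProof N → ℕ
  | leaf _ => 1
  | node1 _ s => s.length + 1
  | node2 _ s t => s.length + t.length + 1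

/-- A valid tree-like `sem(F)` derivation from the CNF formula `A`: every line either is
the indicator of the falsifying assignments of a clause of `A`, or belongs to `F` and is
semantically implied by its (at most two) premises. -/
def Valid {N : ℕ} (F : Set (BFunc N)) (A : Finset (Clause N)) : SemProof N → Prop
  | leaf f => ∃ c ∈ A, f = falsInd c
  | node1 f s => ((∃ c ∈ A, f = falsInd c) ∨
      (f ∈ F ∧ ∀ α, f α = true → s.root α = true)) ∧ Valid F A s
  | node2 f s t => ((∃ c ∈ A, f = falsInd c) ∨
      (f ∈ F ∧ ∀ α, f α = true → s.root α = true ∨ t.root α = true)) ∧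
      Valid F A s ∧ Valid F A t

end SemProof

/-- A tree-like `sem(F)` refutation of `A`: a valid derivation whose final line is the
constant-`1` function (ruling out every assignment, i.e. contradiction). -/
def IsRefutation {N : ℕ} (F : Set (BFunc N)) (A : Finset (Clause N)) (π : SemProof N) : Prop :=
  SemProof.Valid F A π ∧ ∀ α, π.root α = true

/-- A tree-like `sem(F)` derivation of the function `g` from `A`. -/
def IsDerivation {N : ℕ} (F : Set (BFunc N)) (A : Finset (Clause N)) (π : SemProof N)
    (g : BFunc N) : Prop :=
  SemProof.Valid F A π ∧ π.root = g


open Classical in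
/-- The Tseitin contradiction `Tseitin(G,α)` for the graph on `Fin m` with edge set `E`
(variables `Fin N` naming the edges via the bijection `idx`) and charge vector `α`:
for each vertex `v` the parity constraint `Σ_{e ∋ v} x_e ≡ α_v (mod 2)` is encoded by
one clause for each assignment of the edges incident to `v` of the wrong parity. -/
noncomputable def tseitinCNF (m N : ℕ) (E : Finset (Sym2 (Fin m)))
    (idx : {e : Sym2 (Fin m) // e ∈ E} → Fin N) (α : Fin m → Bool) : Finset (Clause N) :=
  Finset.univ.biUnion fun v : Fin m =>
    (Finset.univ.filter fun σ : {e : Sym2 (Fin m) // e ∈ E} → Bool =>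
        (∑ e : {e : Sym2 (Fin m) // e ∈ E},
            if v ∈ (e : Sym2 (Fin m)) ∧ σ e = true then 1 else 0) % 2 ≠
          ((if α v then 1 else 0) : ℕ)).image
      fun σ => (fun w =>
        if h : ∃ e : {e : Sym2 (Fin m) // e ∈ E}, idx e = w ∧ v ∈ (e : Sym2 (Fin m))
        then some (!(σ h.choose)) else none : Clause N)

section Helpers

/-- The value of a Boolean in `ZMod 2`. -/
def bitv (b : Bool) : ZMod 2 := if b then 1 else 0

/-- A linear form over `ZMod 2`. -/
def linf {N : ℕ} (a : Fin N → ZMod 2) (x : Fin N → Bool) : ZMod 2 := ∑ i, a i * bitv (x i)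

/-- Lines: a term together with a parity condition. -/
def lineF {N : ℕ} (p : Finset (Fin N) × (Fin N → Bool) × (Fin N → ZMod 2) × ZMod 2) : BFunc N :=
  fun x => decide ((∀ i ∈ p.1, x i = p.2.1 i) ∧ linf p.2.2.1 x = p.2.2.2)

/-- Parity over a set. -/
def parS {N : ℕ} (S : Finset (Fin N)) (x : Fin N → Bool) : ZMod 2 := ∑ i ∈ S, bitv (x i)

def indS {N : ℕ} (S : Finset (Fin N)) : Fin N → ZMod 2 := fun i => if i ∈ S then 1 else 0

lemma linf_indS {N : ℕ} (S : Finset (Fin N)) (x : Fin N → Bool) :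
    linf (indS S) x = parS S x := by
  simp [linf, indS, parS, Finset.sum_ite_mem]

def clauseOf {N : ℕ} (S : Finset (Fin N)) (τ : Fin N → Bool) : Clause N :=
  fun i => if i ∈ S then some (!(τ i)) else none

lemma falsInd_clauseOf {N : ℕ} (S : Finset (Fin N)) (τ x : Fin N → Bool) :
    falsInd (clauseOf S τ) x = true ↔ ∀ i ∈ S, x i = τ i := by
  rw [falsInd, decide_eq_true_iff]
  simp only [clauseOf]
  constructor
  · intro h i hi
    have := h i (!(τ i)) (by simp [hi])
    revert this
    cases x i <;> cases τ i <;> simp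
  · intro h i b hb
    by_cases hi : i ∈ S
    · simp [hi] at hb
      rw [h i hi, hb]
      cases b <;> simp
    · simp [hi] at hb

lemma sem_sound {N : ℕ} (F : Set (BFunc N)) (A : Finset (Clause N)) (x : Fin N → Bool)
    (π : SemProof N) : SemProof.Valid F A π → π.root x = true →
      ∃ c ∈ A, falsInd c x = true := by
  induction π with
  | leaf f =>
    rintro ⟨c, hc, rfl⟩ h
    exact ⟨c, hc, h⟩
  | node1 f s ih =>
    rintro ⟨h1, h2⟩ h
    rcases h1 with ⟨c, hc, rfl⟩ | ⟨_, h1⟩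
    · exact ⟨c, hc, h⟩
    · exact ih h2 (h1 x h)
  | node2 f s t ih1 ih2 =>
    rintro ⟨h1, h2, h3⟩ h
    rcases h1 with ⟨c, hc, rfl⟩ | ⟨_, h1⟩
    · exact ⟨c, hc, h⟩
    · rcases h1 x h with h1 | h1
      · exact ih1 h2 h1
      · exact ih2 h3 h1

lemma bitv_cover (u : ZMod 2) : bitv (decide (u = 1)) = u := by
  revert u; decide

lemma bitv_inj {a b : Bool} (h : bitv a = bitv b) : a = b := by
  revert a b; decide

lemma parS_congr {N : ℕ} {S : Finset (Fin N)} {x y : Fin N → Bool}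
    (h : ∀ i ∈ S, x i = y i) : parS S x = parS S y :=
  Finset.sum_congr rfl fun i hi => by rw [h i hi]

lemma vertex_tree {N : ℕ} (A : Finset (Clause N)) (S : Finset (Fin N)) (b : ZMod 2)
    (hA : ∀ τ, parS S τ = b → clauseOf S τ ∈ A) (k : ℕ) :
    ∀ (T R : Finset (Fin N)) (ρ : Fin N → Bool) (b' : ZMod 2), R.card = k + 1 →
      Disjoint T R → T ∪ R = S → parS T ρ + b' = b →
      ∃ π : SemProof N, SemProof.Valid (Set.range lineF) A π ∧
        (∀ x, π.root x = true ↔ (∀ i ∈ T, x i = ρ i) ∧ parS R x = b') ∧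
        π.length + 1 ≤ 2 ^ (k + 1) := by
  induction k with
  | zero =>
    intro T R ρ b' hR hd hS hb
    obtain ⟨i, rfl⟩ := Finset.card_eq_one.mp hR
    have hi : i ∉ T := by simpa using hd
    let τ := Function.update ρ i (decide (b' = 1))
    have hτT : ∀ j ∈ T, τ j = ρ j := by
      intro j hj
      have : j ≠ i := by rintro rfl; exact hi hj
      simp [τ, this]
    have hτi : τ i = decide (b' = 1) := by simp [τ]
    have hpar : parS S τ = b := by
      rw [← hS, ← hb, parS, Finset.sum_union hd]
      congr 1
      · exact parS_congr hτT
      · rw [Finset.sum_singleton, hτi, bitv_cover]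
    refine ⟨.leaf (falsInd (clauseOf S τ)), ⟨_, hA τ hpar, rfl⟩, ?_, by simp [SemProof.length]⟩
    intro x
    rw [SemProof.root, falsInd_clauseOf, ← hS]
    constructor
    · intro h
      refine ⟨fun j hj => by rw [h j (by simp [hj]), hτT j hj], ?_⟩
      rw [parS, Finset.sum_singleton, h i (by simp), hτi, bitv_cover]
    · rintro ⟨h1, h2⟩ j hj
      rw [parS, Finset.sum_singleton] at h2
      rcases Finset.mem_union.mp hj with hj | hj
      · rw [h1 j hj, hτT j hj]
      · rw [Finset.mem_singleton.mp hj, hτi]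
        exact bitv_inj (by rw [h2, bitv_cover])
  | succ k ih =>
    intro T R ρ b' hR hd hS hb
    obtain ⟨i, R', hiR, rfl, hR'⟩ := Finset.card_eq_succ.mp hR
    rw [Finset.disjoint_insert_right] at hd
    obtain ⟨hiT, hd⟩ := hd
    have key : ∀ c : Bool, ∃ π : SemProof N, SemProof.Valid (Set.range lineF) A π ∧
        (∀ x, π.root x = true ↔ ((∀ j ∈ T, x j = ρ j) ∧ x i = c) ∧ parS R' x = b' - bitv c) ∧
        π.length + 1 ≤ 2 ^ (k + 1) := by
      intro c
      have hT : ∀ j ∈ T, Function.update ρ i c j = ρ j := by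
        intro j hj
        have : j ≠ i := by rintro rfl; exact hiT hj
        simp [this]
      obtain ⟨π, h1, h2, h3⟩ := ih (insert i T) R' (Function.update ρ i c) (b' - bitv c) hR'
        (by rw [Finset.disjoint_insert_left]; exact ⟨hiR, hd⟩)
        (by rw [← hS]; simp)
        (by
          rw [parS, Finset.sum_insert hiT, ← hb]
          have := parS_congr hT
          rw [parS] at this
          rw [this]
          simp only [Function.update_self]
          ring)
      refine ⟨π, h1, fun x => ?_, h3⟩
      rw [h2 x]
      refine and_congr_left fun _ => ?_
      rw [Finset.forall_mem_insert, Function.update_self, and_comm]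
      refine and_congr_left fun _ => forall₂_congr fun j hj => ?_
      rw [hT j hj]
    obtain ⟨π0, h01, h02, h03⟩ := key false
    obtain ⟨π1, h11, h12, h13⟩ := key true
    refine ⟨.node2 (lineF (T, ρ, indS (insert i R'), b')) π0 π1,
      ⟨Or.inr ⟨⟨_, rfl⟩, ?_⟩, h01, h11⟩, ?_, ?_⟩
    · intro x hx
      simp only [lineF, decide_eq_true_eq, linf_indS] at hx
      obtain ⟨hx1, hx2⟩ := hx
      rw [parS, Finset.sum_insert hiR] at hx2
      rw [h02, h12]
      cases hxi : x i
      · left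
        refine ⟨⟨hx1, rfl⟩, ?_⟩
        rw [← hx2, hxi, parS]; ring
      · right
        refine ⟨⟨hx1, rfl⟩, ?_⟩
        rw [← hx2, hxi, parS]; ring
    · intro x
      simp only [SemProof.root, lineF, decide_eq_true_eq, linf_indS]
    · simp only [SemProof.length]
      rw [pow_succ]
      omega

lemma union_tree {N : ℕ} {V : Type*} [DecidableEq V] (A : Finset (Clause N))
    (S : V → Finset (Fin N)) (b : V → ZMod 2) (L : ℕ) (U : Finset V) (hU : U.Nonempty) :
    (∀ v ∈ U, ∃ π : SemProof N, SemProof.Valid (Set.range lineF) A π ∧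
        (∀ x, π.root x = true ↔ parS (S v) x = b v + 1) ∧ π.length ≤ L) →
    ∃ π : SemProof N, SemProof.Valid (Set.range lineF) A π ∧
        (∀ x, π.root x = true ↔ ∑ v ∈ U, parS (S v) x = ∑ v ∈ U, b v + 1) ∧
        π.length ≤ U.card * (L + 1) := by
  induction hU using Finset.Nonempty.cons_induction with
  | singleton v =>
    intro h
    obtain ⟨π, h1, h2, h3⟩ := h v (by simp)
    exact ⟨π, h1, fun x => by simp [h2 x], by simp; omega⟩
  | cons v U hv hU ih =>
    intro h
    obtain ⟨π, h1, h2, h3⟩ := ih fun w hw => h w (by simp [hw])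
    obtain ⟨π', h1', h2', h3'⟩ := h v (by simp)
    refine ⟨.node2 (lineF (∅, fun _ => false, ∑ w ∈ Finset.cons v U hv, indS (S w),
      ∑ w ∈ Finset.cons v U hv, b w + 1)) π' π, ?_⟩
    have hroot : ∀ x, lineF (∅, fun _ => false, ∑ w ∈ Finset.cons v U hv, indS (S w),
      ∑ w ∈ Finset.cons v U hv, b w + 1) x = true ↔
      ∑ w ∈ Finset.cons v U hv, parS (S w) x = ∑ w ∈ Finset.cons v U hv, b w + 1 := by
      intro x
      have : linf (∑ w ∈ Finset.cons v U hv, indS (S w)) x =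
          ∑ w ∈ Finset.cons v U hv, parS (S w) x := by
        simp only [← linf_indS]
        simp only [linf, Finset.sum_apply, Finset.sum_mul]
        rw [Finset.sum_comm]
      simp only [lineF, decide_eq_true_eq, this]
      simp
    refine ⟨⟨Or.inr ⟨⟨_, rfl⟩, ?_⟩, h1', h1⟩, hroot, ?_⟩
    · intro x hx
      rw [hroot, Finset.sum_cons, Finset.sum_cons] at hx
      rw [h2, h2']
      generalize (∑ w ∈ U, parS (S w) x) = p at *
      generalize (∑ w ∈ U, b w) = q at *
      generalize parS (S v) x = r at *
      generalize b v = s at *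
      clear * - hx
      revert p q r s
      decide
    · simp only [SemProof.length, Finset.card_cons]
      rw [add_mul]
      omega

lemma card_bound {N : ℕ} (A : Finset (Clause N)) (S : Finset (Fin N)) (hS : S.Nonempty)
    (b : ZMod 2) (hA : ∀ τ, parS S τ = b → clauseOf S τ ∈ A) : 2 ^ S.card ≤ 2 * A.card := by
  classical
  obtain ⟨i, hi⟩ := hS
  have hex : ∀ P : Finset (Fin N), ∃ τ : Fin N → Bool, parS S τ = b ∧
      ∀ j ∈ S.erase i, (τ j = true ↔ j ∈ P) := by
    intro P
    let ρ : Fin N → Bool := fun j => decide (j ∈ P)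
    let τ := Function.update ρ i (decide (b - parS (S.erase i) ρ = 1))
    have hτ : ∀ j ∈ S.erase i, τ j = ρ j := by
      intro j hj
      simp [τ, Finset.ne_of_mem_erase hj]
    refine ⟨τ, ?_, fun j hj => by rw [hτ j hj]; simp [ρ]⟩
    rw [parS, ← Finset.add_sum_erase _ _ hi]
    have h1 := parS_congr hτ
    rw [parS] at h1
    rw [h1]
    have : τ i = decide (b - parS (S.erase i) ρ = 1) := by simp [τ]
    rw [this, bitv_cover]
    ring
  choose f hf1 hf2 using hex
  have h := Finset.card_le_card_of_injOn (s := (S.erase i).powerset) (t := A)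
    (fun P => clauseOf S (f P)) (fun P _ => hA _ (hf1 P)) (by
      intro P hP Q hQ hPQ
      simp only [Finset.coe_powerset, Set.mem_preimage, Set.mem_powerset_iff,
        Finset.coe_subset] at hP hQ
      have : ∀ j ∈ S.erase i, (j ∈ P ↔ j ∈ Q) := by
        intro j hj
        rw [← hf2 P j hj, ← hf2 Q j hj]
        have := congrFun hPQ j
        simp only [clauseOf, Finset.mem_of_mem_erase hj, if_true, Option.some.injEq] at this
        rw [Bool.not_inj this]
      ext j
      constructor
      · intro hj; exact (this j (hP hj)).mp hj
      · intro hj; exact (this j (hQ hj)).mpr hj)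
  rw [Finset.card_powerset, Finset.card_erase_of_mem hi] at h
  have : 0 < S.card := Finset.card_pos.mpr ⟨i, hi⟩
  obtain ⟨k, hk⟩ : ∃ k, S.card = k + 1 := ⟨S.card - 1, by omega⟩
  rw [hk] at h ⊢
  rw [pow_succ]
  simp at h
  omega

open Classical in
/-- The variables incident to a vertex. -/
noncomputable def incS {m N : ℕ} {E : Finset (Sym2 (Fin m))}
    (idx : {e : Sym2 (Fin m) // e ∈ E} → Fin N) (v : Fin m) : Finset (Fin N) :=
  Finset.univ.filter fun i => ∃ e : {e : Sym2 (Fin m) // e ∈ E}, idx e = i ∧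
    v ∈ (e : Sym2 (Fin m))

lemma mem_incS {m N : ℕ} {E : Finset (Sym2 (Fin m))}
    {idx : {e : Sym2 (Fin m) // e ∈ E} → Fin N} {v : Fin m} {i : Fin N} :
    i ∈ incS idx v ↔ ∃ e : {e : Sym2 (Fin m) // e ∈ E}, idx e = i ∧
    v ∈ (e : Sym2 (Fin m)) := by
  simp [incS]

lemma mem_incS' {m N : ℕ} {E : Finset (Sym2 (Fin m))}
    {idx : {e : Sym2 (Fin m) // e ∈ E} → Fin N} (hidx : Function.Bijective idx)
    {v : Fin m} {e : {e : Sym2 (Fin m) // e ∈ E}} :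
    idx e ∈ incS idx v ↔ v ∈ (e : Sym2 (Fin m)) := by
  rw [mem_incS]
  constructor
  · rintro ⟨e', h, h'⟩
    rwa [← hidx.1 h]
  · intro h; exact ⟨e, rfl, h⟩

lemma clause_mem {m N : ℕ} {E : Finset (Sym2 (Fin m))}
    (idx : {e : Sym2 (Fin m) // e ∈ E} → Fin N) (hidx : Function.Bijective idx)
    (α : Fin m → Bool) (v : Fin m) (τ : Fin N → Bool)
    (h : parS (incS idx v) τ = bitv (α v) + 1) :
    clauseOf (incS idx v) τ ∈ tseitinCNF m N E idx α := by
  classical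
  rw [tseitinCNF, Finset.mem_biUnion]
  refine ⟨v, Finset.mem_univ _, ?_⟩
  rw [Finset.mem_image]
  refine ⟨fun e => τ (idx e), ?_, ?_⟩
  · rw [Finset.mem_filter]
    refine ⟨Finset.mem_univ _, ?_⟩
    intro hc
    have h1 : (((∑ e : {e : Sym2 (Fin m) // e ∈ E},
            if v ∈ (e : Sym2 (Fin m)) ∧ τ (idx e) = true then 1 else 0 : ℕ) % 2 : ℕ) : ZMod 2)
          = (((if α v then 1 else 0) : ℕ) : ZMod 2) := by
      rw [hc]
    rw [ZMod.natCast_mod] at h1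
    have h2 : (((∑ e : {e : Sym2 (Fin m) // e ∈ E},
            if v ∈ (e : Sym2 (Fin m)) ∧ τ (idx e) = true then 1 else 0 : ℕ) : ℕ) : ZMod 2)
          = parS (incS idx v) τ := by
      have := hidx.sum_comp (fun i => if i ∈ incS idx v then bitv (τ i) else 0)
      rw [Finset.sum_ite_mem, Finset.univ_inter] at this
      rw [parS, ← this]
      push_cast
      refine Finset.sum_congr rfl fun e _ => ?_
      simp only [mem_incS' hidx, bitv]
      by_cases h1 : v ∈ (e : Sym2 (Fin m)) <;> simp [h1]
    rw [h2, h] at h1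
    revert h1
    cases α v <;> simp [bitv]
  · funext w
    by_cases hw : ∃ e : {e : Sym2 (Fin m) // e ∈ E}, idx e = w ∧ v ∈ (e : Sym2 (Fin m))
    · rw [dif_pos hw, clauseOf, if_pos (mem_incS.mpr hw)]
      change (some !(τ (idx hw.choose))) = some !τ w
      rw [hw.choose_spec.1]
    · rw [dif_neg hw, clauseOf, if_neg (fun h => hw (mem_incS.mp h))]

lemma exists_par {N : ℕ} {S : Finset (Fin N)} (hS : S.Nonempty) (b : ZMod 2) :
    ∃ τ, parS S τ = b := by
  obtain ⟨i, hi⟩ := hS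
  refine ⟨Function.update (fun _ => false) i (decide (b = 1)), ?_⟩
  rw [parS, Finset.sum_eq_single i]
  · simp [bitv_cover]
  · intro j _ hj; simp [hj, bitv]
  · intro h; exact absurd hi h

lemma vertex_count {m N : ℕ} {E : Finset (Sym2 (Fin m))}
    (idx : {e : Sym2 (Fin m) // e ∈ E} → Fin N) (hidx : Function.Bijective idx)
    (α : Fin m → Bool) (U : Finset (Fin m)) (hU : ∀ v ∈ U, (incS idx v).Nonempty) :
    U.card ≤ (tseitinCNF m N E idx α).card * 2 := by
  classical
  let g : Clause N → Finset (Fin m) := fun c =>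
    if h : ∃ e : {e : Sym2 (Fin m) // e ∈ E}, c (idx e) ≠ none then
      (h.choose : Sym2 (Fin m)).toFinset else ∅
  have hg : ∀ c, (g c).card ≤ 2 := by
    intro c
    simp only [g]
    split_ifs with h
    · rw [Sym2.card_toFinset]; split_ifs <;> omega
    · simp
  have hsub : U ⊆ (tseitinCNF m N E idx α).biUnion g := by
    intro v hv
    obtain ⟨τ, hτ⟩ := exists_par (hU v hv) (bitv (α v) + 1)
    rw [Finset.mem_biUnion]
    refine ⟨_, clause_mem idx hidx α v τ hτ, ?_⟩
    have h : ∃ e : {e : Sym2 (Fin m) // e ∈ E}, clauseOf (incS idx v) τ (idx e) ≠ none := by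
      obtain ⟨i, hi⟩ := hU v hv
      obtain ⟨e, rfl⟩ := hidx.2 i
      exact ⟨e, by simp [clauseOf, hi]⟩
    simp only [g]
    rw [dif_pos h, Sym2.mem_toFinset]
    have := h.choose_spec
    by_contra hcon
    apply this
    rw [clauseOf, if_neg]
    rw [mem_incS' hidx]
    exact hcon
  exact (Finset.card_le_card hsub).trans (Finset.card_biUnion_le_card_mul _ _ _ fun c _ => hg c)

lemma handshake {m N : ℕ} {E : Finset (Sym2 (Fin m))}
    (idx : {e : Sym2 (Fin m) // e ∈ E} → Fin N) (hidx : Function.Bijective idx)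
    (hE : ∀ e ∈ E, ¬ e.IsDiag) (x : Fin N → Bool) :
    ∑ v : Fin m, parS (incS idx v) x = 0 := by
  classical
  have : ∀ v, parS (incS idx v) x = ∑ i, if i ∈ incS idx v then bitv (x i) else 0 := by
    intro v; rw [Finset.sum_ite_mem, Finset.univ_inter, parS]
  simp only [this]
  rw [Finset.sum_comm]
  refine Finset.sum_eq_zero fun i _ => ?_
  obtain ⟨e, rfl⟩ := hidx.2 i
  simp only [mem_incS' hidx]
  rw [← Finset.sum_filter, Finset.sum_const]
  have : (Finset.univ.filter fun v => v ∈ (e : Sym2 (Fin m))) = (e : Sym2 (Fin m)).toFinset := by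
    ext v; simp
  rw [this, Sym2.card_toFinset_of_not_isDiag _ (hE e e.2), two_nsmul]
  exact CharTwo.add_self_eq_zero _

lemma general_refutation (m N : ℕ) (E : Finset (Sym2 (Fin m)))
    (idx : {e : Sym2 (Fin m) // e ∈ E} → Fin N) (α : Fin m → Bool)
    (hE : ∀ e ∈ E, ¬ e.IsDiag) (hidx : Function.Bijective idx)
    (hα : (∑ v : Fin m, ((if α v then 1 else 0) : ℕ)) % 2 = 1) :
    ∃ π : SemProof N, IsRefutation (Set.range lineF) (tseitinCNF m N E idx α) π ∧
      π.length ≤ 20 * ((tseitinCNF m N E idx α).card + 1) ^ 2 := by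
  classical
  set A := tseitinCNF m N E idx α with hAdef
  have hsum : ∑ v, bitv (α v) = 1 := by
    have h : (((∑ v : Fin m, ((if α v then 1 else 0) : ℕ)) % 2 : ℕ) : ZMod 2) = 1 := by
      rw [hα]; simp
    rw [ZMod.natCast_mod] at h
    push_cast at h
    simpa [bitv] using h
  by_cases hiso : ∃ v, incS idx v = ∅ ∧ α v = true
  · obtain ⟨v, hv, hαv⟩ := hiso
    have hc := clause_mem idx hidx α v (fun _ => false) (by
      rw [hv, hαv, parS, Finset.sum_empty]; decide)
    refine ⟨.leaf (falsInd (clauseOf (incS idx v) fun _ => false)), ⟨⟨_, hc, rfl⟩, ?_⟩, ?_⟩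
    · intro x
      rw [SemProof.root, falsInd_clauseOf, hv]
      simp
    · simp only [SemProof.length]
      have : 0 < (A.card + 1) ^ 2 := by positivity
      omega
  · push Not at hiso
    let U := Finset.univ.filter fun v => (incS idx v).Nonempty
    have hb : ∑ v ∈ U, bitv (α v) = 1 := by
      rw [← hsum]
      refine Finset.sum_subset (Finset.subset_univ _) fun v _ hv => ?_
      have : incS idx v = ∅ := by simpa [U] using hv
      have := hiso v this
      simp [bitv, this]
    have hp : ∀ x, ∑ v ∈ U, parS (incS idx v) x = 0 := by
      intro x
      rw [← handshake idx hidx hE x]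
      refine Finset.sum_subset (Finset.subset_univ _) fun v _ hv => ?_
      have : incS idx v = ∅ := by simpa [U] using hv
      simp [parS, this]
    have hUne : U.Nonempty := by
      rw [Finset.nonempty_iff_ne_empty]
      intro h
      rw [h] at hb
      simp at hb
    have hmem : ∀ v ∈ U, (incS idx v).Nonempty := fun v hv => by simpa [U] using hv
    obtain ⟨π, h1, h2, h3⟩ := union_tree A (incS idx) (fun v => bitv (α v)) (2 * A.card) U hUne (by
      intro v hv
      have hne := hmem v hv
      have hpos := Finset.card_pos.mpr hne
      obtain ⟨k, hk⟩ : ∃ k, (incS idx v).card = k + 1 := ⟨(incS idx v).card - 1, by omega⟩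
      obtain ⟨π, h1, h2, h3⟩ := vertex_tree A (incS idx v) (bitv (α v) + 1)
        (fun τ hτ => clause_mem idx hidx α v τ hτ) k ∅ (incS idx v) (fun _ => false)
        (bitv (α v) + 1) hk (by simp) (by simp) (by simp [parS])
      have h4 := card_bound A (incS idx v) hne (bitv (α v) + 1)
        (fun τ hτ => clause_mem idx hidx α v τ hτ)
      rw [hk] at h4
      exact ⟨π, h1, fun x => by simpa using h2 x, by omega⟩)
    refine ⟨π, ⟨h1, ?_⟩, ?_⟩
    · intro x
      rw [h2, hp, hb]
      decide
    · have h5 := vertex_count idx hidx α U hmem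
      rw [← hAdef] at h5
      calc π.length ≤ U.card * (2 * A.card + 1) := h3
        _ ≤ (A.card * 2) * (2 * A.card + 1) := Nat.mul_le_mul_right _ h5
        _ ≤ _ := by nlinarith

lemma small_refutation {N : ℕ} (hN : N ≤ 1) (A : Finset (Clause N))
    (h : ∀ x, ∃ c ∈ A, falsInd c x = true) :
    ∃ π : SemProof N, IsRefutation {fun _ => true} A π ∧ π.length = 3 := by
  obtain ⟨c, hc, hc'⟩ := h fun _ => false
  obtain ⟨d, hd, hd'⟩ := h fun _ => true
  refine ⟨.node2 (fun _ => true) (.leaf (falsInd c)) (.leaf (falsInd d)),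
    ⟨⟨Or.inr ⟨rfl, ?_⟩, ⟨c, hc, rfl⟩, ⟨d, hd, rfl⟩⟩, fun _ => rfl⟩, rfl⟩
  intro x _
  simp only [SemProof.root]
  have : x = (fun _ => false) ∨ x = (fun _ => true) := by
    rcases Nat.le_one_iff_eq_zero_or_eq_one.mp hN with rfl | rfl
    · left; exact Subsingleton.elim _ _
    · cases hx : x 0
      · left; funext i; rw [Subsingleton.elim i 0, hx]
      · right; funext i; rw [Subsingleton.elim i 0, hx]
  rcases this with rfl | rfl
  · exact Or.inl hc'
  · exact Or.inr hd'

lemma range_card (N : ℕ) : (Set.range (lineF (N := N))).ncard ≤ 2 ^ (3 * N + 1) := by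
  rw [← Set.image_univ]
  refine (Set.ncard_image_le Set.finite_univ).trans ?_
  rw [Set.ncard_univ, Nat.card_eq_fintype_card]
  simp only [Fintype.card_prod, Fintype.card_finset, Fintype.card_fin, Fintype.card_fun,
    Fintype.card_bool, ZMod.card]
  apply le_of_eq
  ring

end Helpers

/-- Proposition 3.9: the family of Tseitin contradictions is simple:
there is a sequence `F = (F_n)` with `|F_n| ≤ 2^{O(n log n)}` such that every Tseitin
contradiction over `n` variables has a tree-like `sem(F)` refutation of length
polynomial in its number of clauses. -/
theorem tseitin_is_simple :
    ∃ F : (n : ℕ) → Set (BFunc n), ∃ C c₂ : ℝ, 0 < c₂ ∧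
      (∀ n : ℕ, ((F n).ncard : ℝ) ≤ (2 : ℝ) ^ (C * n * Real.logb 2 n)) ∧
      ∀ (m N : ℕ) (E : Finset (Sym2 (Fin m)))
        (idx : {e : Sym2 (Fin m) // e ∈ E} → Fin N) (α : Fin m → Bool),
        (∀ e ∈ E, ¬ e.IsDiag) → N = E.card → Function.Bijective idx →
        (∑ v : Fin m, ((if α v then 1 else 0) : ℕ)) % 2 = 1 →
        ∃ π : SemProof N, IsRefutation (F N) (tseitinCNF m N E idx α) π ∧
          (π.length : ℝ) ≤ c₂ * (((tseitinCNF m N E idx α).card : ℝ) + 1) ^ c₂ := by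
  classical
  refine ⟨fun n => if n ≤ 1 then {fun _ => true} else Set.range lineF, 4, 20, by norm_num, ?_, ?_⟩
  · intro n
    by_cases hn : n ≤ 1
    · simp only [hn, if_true, Set.ncard_singleton]
      have : Real.logb 2 n = 0 := by
        rcases Nat.le_one_iff_eq_zero_or_eq_one.mp hn with rfl | rfl <;> simp
      simp [this]
    · simp only [hn, if_false]
      have hn2 : (2 : ℝ) ≤ n := by exact_mod_cast (by omega : 2 ≤ n)
      have hlog : 1 ≤ Real.logb 2 n := by
        rw [Real.le_logb_iff_rpow_le (by norm_num) (by linarith)]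
        simpa using hn2
      calc ((Set.range (lineF (N := n))).ncard : ℝ) ≤ ((2 ^ (3 * n + 1) : ℕ) : ℝ) := by
            exact_mod_cast range_card n
        _ = (2 : ℝ) ^ ((3 * n + 1 : ℕ) : ℝ) := by rw [Real.rpow_natCast]; push_cast; rfl
        _ ≤ _ := by
            apply Real.rpow_le_rpow_of_exponent_le (by norm_num)
            push_cast
            nlinarith
  · intro m N E idx α hE _ hidx hα
    obtain ⟨π, h1, h2⟩ := general_refutation m N E idx α hE hidx hα
    have hone : (1 : ℝ) ≤ ((tseitinCNF m N E idx α).card : ℝ) + 1 := by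
      have : (0 : ℝ) ≤ ((tseitinCNF m N E idx α).card : ℝ) := by positivity
      linarith
    by_cases hN : N ≤ 1
    · obtain ⟨π', h1', h2'⟩ := small_refutation hN (tseitinCNF m N E idx α)
        fun x => sem_sound _ _ x π h1.1 (h1.2 x)
      refine ⟨π', by simpa [hN] using h1', ?_⟩
      rw [h2']
      have := Real.one_le_rpow hone (by norm_num : (0 : ℝ) ≤ 20)
      push_cast
      linarith
    · refine ⟨π, by simpa [hN] using h1, ?_⟩
      calc (π.length : ℝ) ≤ 20 * (((tseitinCNF m N E idx α).card : ℝ) + 1) ^ 2 := by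
            exact_mod_cast h2
        _ ≤ _ := by
            have := Real.rpow_le_rpow_of_exponent_le hone (by norm_num : (2 : ℝ) ≤ 20)
            rw [Real.rpow_two] at this
            linarith
end

section
/- For any simple sequence (A_n : n ∈ ℕ) of families of n-variate CNF formulas and any gadget g : {0,1}^m → {0,1}, the lifted sequence ({A ∘ gⁿ : A ∈ A_n} : n ∈ ℕ) is also simple. -/
/-- A sequence `(A_n)` of families of `n`-variate CNF formulas is *simple* if there is a
sequence `F = (F_n)` of families of `n`-variate Boolean functions with
`|F_n| ≤ 2^{O(n·log n)}` such that tree-like `sem(F)` refutes every `A ∈ A_n` in length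
polynomial in the number of clauses of `A`. -/
def Simple (A : (n : ℕ) → Set (Finset (Clause n))) : Prop :=
  ∃ F : (n : ℕ) → Set (BFunc n), ∃ C c₂ : ℝ, 0 < c₂ ∧
    (∀ n : ℕ, ((F n).ncard : ℝ) ≤ (2 : ℝ) ^ (C * n * Real.logb 2 n)) ∧
    ∀ n : ℕ, ∀ A' ∈ A n, ∃ π : SemProof n, IsRefutation (F n) A' π ∧
      (π.length : ℝ) ≤ c₂ * ((A'.card : ℝ) + 1) ^ c₂

open Classical in
/-- The lifted CNF formula `A ∘ gⁿ`: every variable `x_i` of `A` is replaced by the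
gadget `g` applied to a fresh block of `m` variables, and the result is expanded into a
CNF formula (one clause for every assignment to the blocks of the variables of a clause
`c ∈ A` under which the `g`-values falsify `c`). -/
noncomputable def liftCNF {n : ℕ} (m : ℕ) (g : (Fin m → Bool) → Bool)
    (A : Finset (Clause n)) : Finset (Clause (n * m)) :=
  A.biUnion fun c =>
    (Finset.univ.filter fun ρ : Fin n → Fin m → Bool =>
        ∀ i b, c i = some b → g (ρ i) ≠ b).image
      fun ρ => (fun w =>
        if c (finProdFinEquiv.symm w).1 ≠ none
        then some (!(ρ (finProdFinEquiv.symm w).1 (finProdFinEquiv.symm w).2)) else none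
        : Clause (n * m))

/-- The lifted sequence `({A ∘ gⁿ : A ∈ A_n} : n ∈ ℕ)`, re-indexed by the number of
variables. -/
def liftedFamily (A : (n : ℕ) → Set (Finset (Clause n))) (m : ℕ)
    (g : (Fin m → Bool) → Bool) : (N : ℕ) → Set (Finset (Clause N)) :=
  fun N => {B | ∃ n : ℕ, ∃ A' ∈ A n, ∃ h : n * m = N, B = h ▸ liftCNF m g A'}

/-- A constituent of the lifted formula: the expansion of the lifting of one clause. -/
def liftOne {n : ℕ} (m : ℕ) (c : Clause n) (ρ : Fin n → Fin m → Bool) : Clause (n * m) :=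
  fun w => if c (finProdFinEquiv.symm w).1 ≠ none
        then some (!(ρ (finProdFinEquiv.symm w).1 (finProdFinEquiv.symm w).2)) else none

open Classical in
/-- All clauses of the expansion of one lifted clause. -/
noncomputable def liftC {n : ℕ} (m : ℕ) (g : (Fin m → Bool) → Bool) (c : Clause n) :
    Finset (Clause (n * m)) :=
  (Finset.univ.filter fun ρ : Fin n → Fin m → Bool =>
        ∀ i b, c i = some b → g (ρ i) ≠ b).image (liftOne m c)

/-- Evaluating the gadgets. -/
def gadgetEval {n m : ℕ} (g : (Fin m → Bool) → Bool) (α : Fin (n * m) → Bool) : Fin n → Bool :=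
  fun i => g (fun j => α (finProdFinEquiv (i, j)))

lemma mem_liftC {n m : ℕ} (g : (Fin m → Bool) → Bool) (c : Clause n) (d : Clause (n * m)) :
    d ∈ liftC m g c ↔ ∃ ρ : Fin n → Fin m → Bool,
      (∀ i b, c i = some b → g (ρ i) ≠ b) ∧ liftOne m c ρ = d := by
  classical
  unfold liftC
  simp only [Finset.mem_image, Finset.mem_filter, Finset.mem_univ, true_and]

lemma mem_liftCNF {n m : ℕ} (g : (Fin m → Bool) → Bool) (A : Finset (Clause n))
    (d : Clause (n * m)) : d ∈ liftCNF m g A ↔ ∃ c ∈ A, d ∈ liftC m g c := by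
  classical
  unfold liftCNF
  rw [Finset.mem_biUnion]
  rfl

lemma falsInd_iff {N : ℕ} (c : Clause N) (α : Fin N → Bool) :
    falsInd c α = true ↔ ∀ i b, c i = some b → α i ≠ b := by
  simp [falsInd]

lemma falsInd_lift {n m : ℕ} (g : (Fin m → Bool) → Bool) (c : Clause n)
    (α : Fin (n * m) → Bool) :
    falsInd c (gadgetEval g α) = true ↔ ∃ d ∈ liftC m g c, falsInd d α = true := by
  constructor
  · intro h
    rw [falsInd_iff] at h
    refine ⟨liftOne m c (fun i j => α (finProdFinEquiv (i, j))), ?_, ?_⟩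
    · rw [mem_liftC]
      exact ⟨_, h, rfl⟩
    · rw [falsInd_iff]
      intro w b hw
      unfold liftOne at hw
      split_ifs at hw
      simp only [Option.some.injEq, Prod.mk.eta, Equiv.apply_symm_apply] at hw
      rw [← hw]
      cases α w <;> simp
  · rintro ⟨d, hd, hf⟩
    rw [mem_liftC] at hd
    obtain ⟨ρ, hρ, rfl⟩ := hd
    rw [falsInd_iff] at hf ⊢
    intro i b hc
    have : (fun j => α (finProdFinEquiv (i, j))) = ρ i := by
      funext j
      have h1 := hf (finProdFinEquiv (i, j)) (!(ρ i j)) (by simp [liftOne, hc])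
      revert h1
      cases α (finProdFinEquiv (i, j)) <;> cases ρ i j <;> simp
    unfold gadgetEval
    rw [this]
    exact hρ i b hc

/-- The disjunction of the falsifying indicators of a list of clauses. -/
def orL {N : ℕ} (l : List (Clause N)) : BFunc N :=
  fun α => decide (∃ d ∈ l, falsInd d α = true)

lemma orL_iff {N : ℕ} (l : List (Clause N)) (α : Fin N → Bool) :
    orL l α = true ↔ ∃ d ∈ l, falsInd d α = true := by
  simp [orL]

lemma derive_orL {N : ℕ} (F : Set (BFunc N)) (B : Finset (Clause N)) :
    ∀ l : List (Clause N), l ≠ [] → (∀ d ∈ l, d ∈ B) →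
      (∀ k < l.length, orL (l.drop k) ∈ F) →
      ∃ π : SemProof N, SemProof.Valid F B π ∧ π.root = orL l ∧ π.length ≤ 2 * l.length
  | [], h, _, _ => absurd rfl h
  | [c], _, hB, _ => by
      refine ⟨.leaf (falsInd c), ⟨c, hB c (by simp), rfl⟩, ?_, by simp [SemProof.length]⟩
      funext α
      rw [Bool.eq_iff_iff, orL_iff]
      simp [SemProof.root]
  | c :: e :: l, _, hB, hF => by
      obtain ⟨π, h1, h2, h3⟩ := derive_orL F B (e :: l) (by simp)
        (fun d hd => hB d (List.mem_cons_of_mem _ hd))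
        (fun k hk => by
          have := hF (k + 1) (by simpa using hk)
          simpa using this)
      refine ⟨.node2 (orL (c :: e :: l)) (.leaf (falsInd c)) π,
        ⟨Or.inr ⟨by simpa using hF 0 (by simp), ?_⟩, ⟨c, hB c (by simp), rfl⟩, h1⟩, rfl, ?_⟩
      · intro α hα
        rw [h2, orL_iff]
        rw [orL_iff] at hα
        obtain ⟨d, hd, hf⟩ := hα
        rcases List.mem_cons.1 hd with rfl | hd
        · exact Or.inl hf
        · exact Or.inr ⟨d, hd, hf⟩
      · simp only [SemProof.length, List.length_cons] at h3 ⊢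
        omega

lemma sound {N : ℕ} (F : Set (BFunc N)) (A : Finset (Clause N)) (α : Fin N → Bool) :
    ∀ π : SemProof N, π.Valid F A → π.root α = true → ∃ c ∈ A, falsInd c α = true := by
  intro π
  induction π with
  | leaf f =>
    rintro ⟨c, hc, rfl⟩ h
    exact ⟨c, hc, h⟩
  | node1 f s ih =>
    rintro ⟨⟨c, hc, rfl⟩ | ⟨_, hi⟩, hs⟩ h
    · exact ⟨c, hc, h⟩
    · exact ih hs (hi α h)
  | node2 f s t ihs iht =>
    rintro ⟨⟨c, hc, rfl⟩ | ⟨_, hi⟩, hs, ht⟩ h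
    · exact ⟨c, hc, h⟩
    · rcases hi α h with h | h
      · exact ihs hs h
      · exact iht ht h

lemma length_pos' {N : ℕ} (π : SemProof N) : 1 ≤ π.length := by
  cases π <;> simp [SemProof.length]

lemma simulate {n m : ℕ} (g : (Fin m → Bool) → Bool) (F : Set (BFunc n))
    (A : Finset (Clause n)) (F' : Set (BFunc (n * m))) (B : Finset (Clause (n * m))) (K : ℕ)
    (hF : ∀ f ∈ F, (fun α => f (gadgetEval g α)) ∈ F')
    (hax : ∀ c ∈ A, ∃ π : SemProof (n * m), π.Valid F' B ∧
      π.root = (fun α => falsInd c (gadgetEval g α)) ∧ π.length ≤ K + 1) :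
    ∀ π : SemProof n, π.Valid F A → ∃ π' : SemProof (n * m), π'.Valid F' B ∧
      π'.root = (fun α => π.root (gadgetEval g α)) ∧ π'.length ≤ π.length * (K + 1) := by
  intro π
  induction π with
  | leaf f =>
    rintro ⟨c, hc, rfl⟩
    obtain ⟨π, h1, h2, h3⟩ := hax c hc
    exact ⟨π, h1, h2, by simpa [SemProof.length] using h3⟩
  | node1 f s ih =>
    rintro ⟨⟨c, hc, rfl⟩ | ⟨hf, hi⟩, hs⟩
    · obtain ⟨π, h1, h2, h3⟩ := hax c hc
      refine ⟨π, h1, h2, h3.trans ?_⟩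
      exact Nat.le_mul_of_pos_left _ (length_pos' _)
    · obtain ⟨π, h1, h2, h3⟩ := ih hs
      refine ⟨.node1 _ π, ⟨Or.inr ⟨hF f hf, ?_⟩, h1⟩, rfl, ?_⟩
      · intro α h
        rw [h2]
        exact hi _ h
      · simp only [SemProof.length]
        nlinarith
  | node2 f s t ihs iht =>
    rintro ⟨⟨c, hc, rfl⟩ | ⟨hf, hi⟩, hs, ht⟩
    · obtain ⟨π, h1, h2, h3⟩ := hax c hc
      refine ⟨π, h1, h2, h3.trans ?_⟩
      exact Nat.le_mul_of_pos_left _ (length_pos' _)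
    · obtain ⟨π, h1, h2, h3⟩ := ihs hs
      obtain ⟨π', h1', h2', h3'⟩ := iht ht
      refine ⟨.node2 _ π π', ⟨Or.inr ⟨hF f hf, ?_⟩, h1, h1'⟩, rfl, ?_⟩
      · intro α h
        rw [h2, h2']
        exact hi _ h
      · simp only [SemProof.length]
        nlinarith

lemma liftC_nonempty {n m : ℕ} (g : (Fin m → Bool) → Bool) (hg : ∀ b, ∃ x, g x = b)
    (c : Clause n) : (liftC m g c).Nonempty := by
  choose p hp using hg
  refine ⟨_, (mem_liftC g c _).2 ⟨fun i => p (!((c i).getD true)), ?_, rfl⟩⟩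
  intro i b hc
  simp [hp, hc]

lemma card_le_lift {n m : ℕ} (g : (Fin m → Bool) → Bool) (hg : ∀ b, ∃ x, g x = b)
    (A : Finset (Clause n)) : A.card ≤ (liftCNF m g A).card := by
  have hm : 0 < m := by
    rcases Nat.eq_zero_or_pos m with rfl | h
    · obtain ⟨x, hx⟩ := hg true
      obtain ⟨y, hy⟩ := hg false
      rw [Subsingleton.elim x y, hy] at hx
      cases hx
    · exact h
  choose p hp using hg
  refine Finset.card_le_card_of_injOn
    (fun c => liftOne m c (fun i => p (!((c i).getD true)))) ?_ ?_
  · intro c hc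
    refine (mem_liftCNF g A _).2 ⟨c, hc, (mem_liftC g c _).2 ⟨_, ?_, rfl⟩⟩
    intro i b hc
    simp [hp, hc]
  · intro c _ c' _ h
    funext i
    have h' : ∀ j, _ := fun j => congrFun h (finProdFinEquiv (i, j))
    simp only [liftOne, Equiv.symm_apply_apply] at h'
    rcases hc : c i with _ | b <;> rcases hc' : c' i with _ | b'
    · rfl
    · have := h' ⟨0, hm⟩
      simp [hc, hc'] at this
    · have := h' ⟨0, hm⟩
      simp [hc, hc'] at this
    · simp [hc, hc'] at h'
      have : p (!b) = p (!b') := funext h'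
      have := congrArg g this
      rw [hp, hp] at this
      simpa using this

/-- The family of functions used for the lifted formulas. -/
def liftF {n : ℕ} (m : ℕ) (g : (Fin m → Bool) → Bool) (F : Set (BFunc n)) :
    Set (BFunc (n * m)) :=
  (fun f : BFunc n => (fun α => f (gadgetEval g α) : BFunc (n * m))) '' F ∪
    Set.range (fun p : Clause n × Fin (3 ^ (n * m)) => orL ((liftC m g p.1).toList.drop p.2))

lemma liftF_ncard {n : ℕ} (m : ℕ) (g : (Fin m → Bool) → Bool) (F : Set (BFunc n)) :
    (liftF m g F).ncard ≤ F.ncard + 3 ^ n * 3 ^ (n * m) := by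
  refine (Set.ncard_union_le _ _).trans (Nat.add_le_add (Set.ncard_image_le (Set.toFinite _)) ?_)
  rw [← Set.image_univ]
  refine (Set.ncard_image_le (Set.toFinite _)).trans ?_
  rw [Set.ncard_univ, Nat.card_eq_fintype_card]
  simp

lemma derive_ax {n m : ℕ} (g : (Fin m → Bool) → Bool) (F : Set (BFunc n))
    (A : Finset (Clause n)) (c : Clause n) (hc : c ∈ A) (hne : (liftC m g c).Nonempty) :
    ∃ π : SemProof (n * m), π.Valid (liftF m g F) (liftCNF m g A) ∧
      π.root = (fun α => falsInd c (gadgetEval g α)) ∧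
      π.length ≤ 2 * (liftCNF m g A).card := by
  obtain ⟨π, h1, h2, h3⟩ := derive_orL (liftF m g F) (liftCNF m g A) (liftC m g c).toList
    (by simpa using hne.ne_empty)
    (fun d hd => (mem_liftCNF g A d).2 ⟨c, hc, by simpa using hd⟩)
    (fun k hk => Or.inr ⟨(c, ⟨k, by
      refine hk.trans_le ?_
      rw [Finset.length_toList]
      refine (Finset.card_le_univ _).trans ?_
      simp⟩), rfl⟩)
  refine ⟨π, h1, ?_, h3.trans ?_⟩
  · rw [h2]
    funext α
    rw [Bool.eq_iff_iff, orL_iff, falsInd_lift]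
    simp
  · rw [Finset.length_toList]
    exact Nat.mul_le_mul_left _ (Finset.card_le_card
      (fun d hd => (mem_liftCNF g A d).2 ⟨c, hc, hd⟩))

lemma lift_refute {n m : ℕ} (g : (Fin m → Bool) → Bool) (F : Set (BFunc n))
    (A : Finset (Clause n)) (π : SemProof n) (hπ : IsRefutation F A π) (c₂ : ℝ) (hc : 0 < c₂)
    (hl : (π.length : ℝ) ≤ c₂ * ((A.card : ℝ) + 1) ^ c₂) :
    ∃ π' : SemProof (n * m), IsRefutation (liftF m g F) (liftCNF m g A) π' ∧
      (π'.length : ℝ) ≤ (2 * c₂ + 3) * (((liftCNF m g A).card : ℝ) + 1) ^ (2 * c₂ + 3) := by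
  set B := liftCNF m g A with hB
  have hB1 : (1 : ℝ) ≤ (B.card : ℝ) + 1 := by
    have : (0 : ℝ) ≤ B.card := Nat.cast_nonneg _
    linarith
  by_cases hg : ∀ b, ∃ x, g x = b
  · obtain ⟨π', h1, h2, h3⟩ := simulate g F A (liftF m g F) B (2 * B.card)
      (fun f hf => Or.inl ⟨f, hf, rfl⟩)
      (fun c hc => by
        obtain ⟨π, h1, h2, h3⟩ := derive_ax g F A c hc (liftC_nonempty g hg c)
        exact ⟨π, h1, h2, h3.trans (Nat.le_succ _)⟩) π hπ.1
    refine ⟨π', ⟨h1, fun α => by rw [h2]; exact hπ.2 _⟩, ?_⟩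
    have hAB : (A.card : ℝ) ≤ B.card := by exact_mod_cast card_le_lift g hg A
    have h3' : (π'.length : ℝ) ≤ π.length * (2 * B.card + 1) := by exact_mod_cast h3
    have hA0 : (0 : ℝ) ≤ A.card := Nat.cast_nonneg _
    calc (π'.length : ℝ) ≤ π.length * (2 * B.card + 1) := h3'
      _ ≤ (c₂ * ((B.card : ℝ) + 1) ^ c₂) * (2 * ((B.card : ℝ) + 1)) := by
          apply mul_le_mul
          · refine hl.trans ?_
            gcongr
          · linarith
          · positivity
          · positivity
      _ = 2 * c₂ * ((B.card : ℝ) + 1) ^ (c₂ + 1) := by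
          rw [Real.rpow_add (by linarith), Real.rpow_one]
          ring
      _ ≤ _ := by
          apply mul_le_mul
          · linarith
          · exact Real.rpow_le_rpow_of_exponent_le hB1 (by linarith)
          · positivity
          · positivity
  · have hconst : ∀ x y, g x = g y := by
      intro x y
      by_contra hxy
      apply hg
      intro b
      by_cases hx : g x = b
      · exact ⟨x, hx⟩
      · refine ⟨y, ?_⟩
        revert hxy hx
        cases g x <;> cases g y <;> cases b <;> simp
    have hG : ∀ α α' : Fin (n * m) → Bool, (gadgetEval g α : Fin n → Bool) = gadgetEval g α' :=
      fun α α' => funext fun i => hconst _ _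
    obtain ⟨c, hcA, hcf⟩ := sound F A (gadgetEval g (fun _ : Fin (n * m) => true)) π hπ.1 (hπ.2 _)
    have hne : (liftC m g c).Nonempty := by
      obtain ⟨d, hd, _⟩ := (falsInd_lift g c _).1 hcf
      exact ⟨d, hd⟩
    obtain ⟨π', h1, h2, h3⟩ := derive_ax g F A c hcA hne
    refine ⟨π', ⟨h1, fun α => by rw [h2]; simp only; rw [hG α, hcf]⟩, ?_⟩
    have h3' : (π'.length : ℝ) ≤ 2 * B.card := by exact_mod_cast h3
    calc (π'.length : ℝ) ≤ 2 * ((B.card : ℝ) + 1) ^ (1 : ℝ) := by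
          rw [Real.rpow_one]
          linarith
      _ ≤ _ := by
          apply mul_le_mul
          · linarith
          · exact Real.rpow_le_rpow_of_exponent_le hB1 (by linarith)
          · positivity
          · positivity

lemma card_bound_s11 (C : ℝ) (n m k : ℕ) (hN : 2 ≤ n * m)
    (hk : (k : ℝ) ≤ (2 : ℝ) ^ (C * n * Real.logb 2 n)) :
    ((k + 3 ^ n * 3 ^ (n * m) : ℕ) : ℝ) ≤
      (2 : ℝ) ^ ((|C| + 5) * ((n * m : ℕ) : ℝ) * Real.logb 2 ((n * m : ℕ) : ℝ)) := by
  have hn : 0 < n := Nat.pos_of_ne_zero (by rintro rfl; simp at hN)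
  have hm : 0 < m := Nat.pos_of_ne_zero (by rintro rfl; simp at hN)
  have hle : n ≤ n * m := Nat.le_mul_of_pos_right _ hm
  generalize n * m = N at *
  have hNR : (2 : ℝ) ≤ N := by exact_mod_cast hN
  have hnR : (1 : ℝ) ≤ n := by exact_mod_cast hn
  have hleR : (n : ℝ) ≤ N := by exact_mod_cast hle
  have hlog : 1 ≤ Real.logb 2 (N : ℝ) := by
    rw [Real.le_logb_iff_rpow_le (by norm_num) (by linarith)]
    simpa using hNR
  have hlogn : 0 ≤ Real.logb 2 (n : ℝ) := Real.logb_nonneg (by norm_num) hnR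
  have hlogle : Real.logb 2 (n : ℝ) ≤ Real.logb 2 (N : ℝ) :=
    Real.logb_le_logb_of_le (by norm_num) (by linarith) hleR
  set T := (N : ℝ) * Real.logb 2 (N : ℝ) with hT
  have hTN : (N : ℝ) ≤ T := by nlinarith
  have e1 : C * n * Real.logb 2 n ≤ (|C| + 4) * T := by
    have : (n : ℝ) * Real.logb 2 n ≤ T := mul_le_mul hleR hlogle hlogn (by linarith)
    have h0 : 0 ≤ (n : ℝ) * Real.logb 2 n := by positivity
    calc C * n * Real.logb 2 n = C * (n * Real.logb 2 n) := by ring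
      _ ≤ |C| * (n * Real.logb 2 n) := by gcongr; exact le_abs_self C
      _ ≤ |C| * T := by gcongr
      _ ≤ _ := by nlinarith
  have e2 : ((3 ^ n * 3 ^ N : ℕ) : ℝ) ≤ (2 : ℝ) ^ ((|C| + 4) * T) := by
    have h1 : 3 ^ n * 3 ^ N ≤ 2 ^ (4 * N) := by
      calc 3 ^ n * 3 ^ N ≤ 3 ^ N * 3 ^ N :=
            Nat.mul_le_mul_right _ (Nat.pow_le_pow_right (by norm_num) hle)
        _ ≤ 4 ^ N * 4 ^ N := by gcongr <;> norm_num
        _ = 2 ^ (4 * N) := by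
            rw [← mul_pow, pow_mul]
            norm_num
    calc ((3 ^ n * 3 ^ N : ℕ) : ℝ) ≤ ((2 ^ (4 * N) : ℕ) : ℝ) := by exact_mod_cast h1
      _ = (2 : ℝ) ^ ((4 * N : ℕ) : ℝ) := by rw [Real.rpow_natCast]; push_cast; rfl
      _ ≤ _ := by
        apply Real.rpow_le_rpow_of_exponent_le (by norm_num)
        push_cast
        have := abs_nonneg C
        nlinarith
  have e3 : (k : ℝ) ≤ (2 : ℝ) ^ ((|C| + 4) * T) :=
    hk.trans (Real.rpow_le_rpow_of_exponent_le (by norm_num) e1)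
  calc ((k + 3 ^ n * 3 ^ N : ℕ) : ℝ) = (k : ℝ) + ((3 ^ n * 3 ^ N : ℕ) : ℝ) := by push_cast; rfl
    _ ≤ (2 : ℝ) ^ ((|C| + 4) * T) * 2 := by linarith
    _ = (2 : ℝ) ^ ((|C| + 4) * T + 1) := by rw [Real.rpow_add (by norm_num), Real.rpow_one]
    _ ≤ _ := by
      apply Real.rpow_le_rpow_of_exponent_le (by norm_num)
      rw [mul_assoc, ← hT]
      nlinarith

lemma small_refute {N : ℕ} (hN : N ≤ 1) (B : Finset (Clause N))
    (h : ∀ α, ∃ c ∈ B, falsInd c α = true) :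
    ∃ π : SemProof N, IsRefutation {fun _ => true} B π ∧ π.length = 3 := by
  obtain ⟨c, hc, hcf⟩ := h (fun _ => true)
  obtain ⟨d, hd, hdf⟩ := h (fun _ => false)
  refine ⟨.node2 (fun _ => true) (.leaf (falsInd c)) (.leaf (falsInd d)),
    ⟨⟨Or.inr ⟨rfl, ?_⟩, ⟨c, hc, rfl⟩, ⟨d, hd, rfl⟩⟩, fun _ => rfl⟩, rfl⟩
  intro α _
  have : α = (fun _ => true) ∨ α = (fun _ => false) := by
    have hs : ∀ i j : Fin N, i = j := fun i j => Fin.ext (by omega)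
    by_cases hh : ∃ i, α i = false
    · right
      obtain ⟨i, hi⟩ := hh
      funext j
      rw [hs j i, hi]
    · left
      funext j
      by_contra hj
      exact hh ⟨j, by simpa using hj⟩
  rcases this with rfl | rfl
  · exact Or.inl hcf
  · exact Or.inr hdf

/-- Proposition 3.10: for any simple sequence `(A_n)` of families of
CNF formulas and any gadget `g : {0,1}^m → {0,1}`, the lifted sequence
`({A ∘ gⁿ : A ∈ A_n})` is also simple. -/
theorem lifted_family_is_simple
    (A : (n : ℕ) → Set (Finset (Clause n))) (m : ℕ) (g : (Fin m → Bool) → Bool)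
    (hA : Simple A) : Simple (liftedFamily A m g) := by
  obtain ⟨F, C, c₂, hc, hF, hR⟩ := hA
  have key : ∀ N : ℕ, ∃ F' : Set (BFunc N),
      ((F'.ncard : ℝ) ≤ (2 : ℝ) ^ ((|C| + 5) * N * Real.logb 2 N)) ∧
      ∀ B ∈ liftedFamily A m g N, ∃ π : SemProof N, IsRefutation F' B π ∧
        (π.length : ℝ) ≤ (2 * c₂ + 3) * ((B.card : ℝ) + 1) ^ (2 * c₂ + 3) := by
    intro N
    by_cases hN : N ≤ 1
    · refine ⟨{fun _ => true}, ?_, ?_⟩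
      · rw [Set.ncard_singleton]
        interval_cases N <;> simp
      · rintro B ⟨n, A', hA', rfl, rfl⟩
        obtain ⟨π, hπ, hl⟩ := hR n A' hA'
        obtain ⟨π', hπ', hl'⟩ := small_refute hN (liftCNF m g A') (fun α => by
          obtain ⟨c, hcA, hcf⟩ := sound _ _ (gadgetEval g α) π hπ.1 (hπ.2 _)
          obtain ⟨d, hd, hdf⟩ := (falsInd_lift g c α).1 hcf
          exact ⟨d, (mem_liftCNF g A' d).2 ⟨c, hcA, hd⟩, hdf⟩)
        refine ⟨π', hπ', ?_⟩
        rw [hl']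
        have h1 : (1 : ℝ) ≤ (((liftCNF m g A').card : ℝ) + 1) ^ (2 * c₂ + 3) :=
          Real.one_le_rpow (by
            have : (0 : ℝ) ≤ (liftCNF m g A').card := Nat.cast_nonneg _
            linarith) (by linarith)
        show ((3 : ℕ) : ℝ) ≤ (2 * c₂ + 3) * (((liftCNF m g A').card : ℝ) + 1) ^ (2 * c₂ + 3)
        push_cast
        nlinarith
    · by_cases hn : ∃ n, n * m = N
      · obtain ⟨n, rfl⟩ := hn
        refine ⟨liftF m g (F n), ?_, ?_⟩
        · refine le_trans (by exact_mod_cast liftF_ncard m g (F n))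
            (card_bound_s11 C n m _ (by omega) (hF n))
        · rintro B ⟨n', A', hA', h, rfl⟩
          have hm : 0 < m := Nat.pos_of_ne_zero (by rintro rfl; simp at hN)
          obtain rfl : n' = n := Nat.eq_of_mul_eq_mul_right hm h
          obtain ⟨π, hπ, hl⟩ := hR n' A' hA'
          exact lift_refute g (F n') A' π hπ c₂ hc hl
      · refine ⟨∅, ?_, ?_⟩
        · rw [Set.ncard_empty, Nat.cast_zero]
          positivity
        · rintro B ⟨n', A', hA', h, rfl⟩
          exact absurd ⟨n', h⟩ hn
  choose F' h1 h2 using key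
  exact ⟨F', |C| + 5, 2 * c₂ + 3, by linarith, h1, h2⟩
end
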